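/- arXiv:1302.4164 — 2 statements merged into one kernel-verified Lean document; each statement's English description precedes it below -/
import Mathlib

section
/- For s > 2, set k = ⌈s-2⌉ (the smallest integer ≥ s-2, assumed > s-2 so that 0 < s-k-1 ≤ 1). For any finite measure σ, dyadic cube Q_0, and nonnegative weights {α_Q}_{Q ⊆ Q_0} (finitely many nonzero, with σ(Q) > 0 when α_Q > 0), the quantities A_1 = ∫_{Q_0} (∑_{Q ⊆ Q_0} (α_Q/σ(Q)) 1_Q)^s dσ and A_2 = ∑_{Q ⊆ Q_0} α_Q ((1/σ(Q)) ∑_{Q' ⊆ Q} α_{Q'})^{s-1} satisfy A_1 ≤ s(s-1)⋯(s-k) · A_1^{k/(s-1)} · A_2^{(s-k-1)/(s-1)}, and hence (if A_1 < ∞) A_1 ≤ (s(s-1)⋯(s-k))^{(s-1)/(s-k-1)} A_2. -/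
open MeasureTheory Finset Classical

noncomputable section

def dyadicCube (n : ℕ) (i : ℤ) (k : Fin n → ℤ) : Set (Fin n → ℝ) :=
  {x | ∀ j, (k j : ℝ) * 2 ^ (-i) ≤ x j ∧ x j < ((k j : ℝ) + 1) * 2 ^ (-i)}

def IsDyadicCube (n : ℕ) (Q : Set (Fin n → ℝ)) : Prop :=
  ∃ i k, Q = dyadicCube n i k

/-- One step of the summation inequality: `(∑ aᵢ)ᵖ ≤ p ∑ aᵢ (∑_{Qⱼ ⊆ Qᵢ} aⱼ)ᵖ⁻¹` along a chain. -/
lemma rpow_sum_le_of_chain {ι Ω : Type*} (Q : ι → Set Ω) {c : ι → ℝ} (hc : ∀ i, 0 ≤ c i)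
    {p : ℝ} (hp : 1 ≤ p) (F : Finset ι)
    (hF : ∀ i ∈ F, ∀ j ∈ F, Q i ⊆ Q j ∨ Q j ⊆ Q i) :
    (∑ i ∈ F, c i) ^ p ≤ p * ∑ i ∈ F, c i * (∑ j ∈ F with Q j ⊆ Q i, c j) ^ (p - 1) := by
  induction F using Finset.strongInduction with
  | H F ih =>
    rcases F.eq_empty_or_nonempty with rfl | hne
    · simp [Real.zero_rpow (by linarith : p ≠ 0)]
    obtain ⟨m, hm, hmax⟩ := F.exists_maximalFor Q hne
    have htop : ∀ j ∈ F, Q j ⊆ Q m := fun j hj =>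
      (hF j hj m hm).elim id fun h => hmax hj h
    have hih := ih (F.erase m) (Finset.erase_ssubset hm) fun i hi j hj =>
      hF i (Finset.mem_of_mem_erase hi) j (Finset.mem_of_mem_erase hj)
    have hfull : (F.filter fun j => Q j ⊆ Q m) = F := Finset.filter_true_of_mem htop
    have hmono : ∑ i ∈ F.erase m, c i * (∑ j ∈ F.erase m with Q j ⊆ Q i, c j) ^ (p - 1) ≤
        ∑ i ∈ F.erase m, c i * (∑ j ∈ F with Q j ⊆ Q i, c j) ^ (p - 1) := by
      refine Finset.sum_le_sum fun i _ => mul_le_mul_of_nonneg_left ?_ (hc i)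
      refine Real.rpow_le_rpow (Finset.sum_nonneg fun j _ => hc j) ?_ (by linarith)
      exact Finset.sum_le_sum_of_subset_of_nonneg
        (Finset.filter_subset_filter _ (Finset.erase_subset _ _)) fun j _ _ => hc j
    rw [← Finset.add_sum_erase F (fun i => c i * (∑ j ∈ F with Q j ⊆ Q i, c j) ^ (p - 1)) hm,
      hfull]
    have hsum := Finset.add_sum_erase F c hm
    set S := ∑ i ∈ F, c i
    have hS0 : 0 ≤ S := Finset.sum_nonneg fun j _ => hc j
    have hR0 : 0 ≤ ∑ i ∈ F.erase m, c i := Finset.sum_nonneg fun j _ => hc j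
    have hbern : S ^ p ≤ p * (c m * S ^ (p - 1)) + (∑ i ∈ F.erase m, c i) ^ p := by
      rcases hS0.eq_or_lt with h0 | hSpos
      · rw [← h0, Real.zero_rpow (by linarith)]
        have := hc m
        positivity
      have hcm : c m ≤ S := by linarith
      have hb := one_add_mul_self_le_rpow_one_add (s := -(c m / S)) (p := p)
        (by have := (div_le_one hSpos).2 hcm; linarith) hp
      have hR : ∑ i ∈ F.erase m, c i = S * (1 + -(c m / S)) := by field_simp; linarith
      have hSp : S ^ p = S * S ^ (p - 1) := by
        rw [← Real.rpow_one_add' hS0 (by linarith)]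
        congr 1
        ring
      have h1 : (0 : ℝ) ≤ 1 + -(c m / S) := by
        have := (div_le_one hSpos).2 hcm
        linarith
      rw [hR, Real.mul_rpow hS0 h1]
      have hmul := mul_le_mul_of_nonneg_left hb (Real.rpow_nonneg hS0 p)
      have : S ^ p * (1 + p * -(c m / S)) = S ^ p - p * (c m * S ^ (p - 1)) := by
        rw [hSp]
        field_simp
        ring
      linarith
    have := mul_le_mul_of_nonneg_left hmono (by linarith : (0 : ℝ) ≤ p)
    linarith

/-- The `(k + 1)`-fold iterate of `rpow_sum_le_of_chain`. -/
lemma rpow_sum_le_prod_mul_of_chain {ι Ω : Type*} (Q : ι → Set Ω) {c : ι → ℝ}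
    (hc : ∀ i, 0 ≤ c i) {s : ℝ} (k : ℕ) (hk : k + 1 ≤ s) (F : Finset ι)
    (hF : ∀ i ∈ F, ∀ j ∈ F, Q i ⊆ Q j ∨ Q j ⊆ Q i) :
    (∑ i ∈ F, c i) ^ s ≤ (∏ j ∈ Finset.range (k + 1), (s - j)) *
      ∑ i ∈ F, c i * (∑ j ∈ F with Q j ⊆ Q i, c j) ^ (s - k - 1) *
        (∑ j ∈ F with Q i ⊆ Q j, c j) ^ k := by
  induction k with
  | zero => simpa using rpow_sum_le_of_chain Q hc (by simpa using hk) F hF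
  | succ k ih =>
    push_cast at hk
    rw [Finset.prod_range_succ]
    refine (ih (by linarith)).trans ?_
    rw [mul_assoc]
    refine mul_le_mul_of_nonneg_left ?_ (Finset.prod_nonneg fun j hj => ?_)
    swap
    · have : (j : ℝ) ≤ k := by exact_mod_cast Nat.lt_succ_iff.1 (Finset.mem_range.1 hj)
      linarith
    set D : ι → ℝ := fun i => ∑ j ∈ F with Q j ⊆ Q i, c j with hD
    set U : ι → ℝ := fun i => ∑ j ∈ F with Q i ⊆ Q j, c j with hU
    have hD0 : ∀ i, 0 ≤ D i := fun i => Finset.sum_nonneg fun j _ => hc j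
    have hU0 : ∀ i, 0 ≤ U i := fun i => Finset.sum_nonneg fun j _ => hc j
    have hstep : ∀ i ∈ F, D i ^ (s - k - 1) ≤
        (s - k - 1) * ∑ l ∈ F with Q l ⊆ Q i, c l * D l ^ (s - k - 1 - 1) := by
      intro i _
      refine (rpow_sum_le_of_chain Q hc (by linarith) (F.filter fun j => Q j ⊆ Q i)
        fun a ha b hb => hF a (Finset.mem_filter.1 ha).1 b (Finset.mem_filter.1 hb).1).trans ?_
      refine mul_le_mul_of_nonneg_left ?_ (by linarith)
      refine Finset.sum_le_sum fun l _ => mul_le_mul_of_nonneg_left ?_ (hc l)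
      refine Real.rpow_le_rpow (Finset.sum_nonneg fun j _ => hc j) ?_ (by linarith)
      exact Finset.sum_le_sum_of_subset_of_nonneg
        (Finset.filter_subset_filter _ (Finset.filter_subset _ _)) fun j _ _ => hc j
    calc ∑ i ∈ F, c i * D i ^ (s - k - 1) * U i ^ k
        ≤ ∑ i ∈ F, c i * ((s - k - 1) *
            ∑ l ∈ F with Q l ⊆ Q i, c l * D l ^ (s - k - 1 - 1)) * U i ^ k := by
          refine Finset.sum_le_sum fun i hi => ?_
          exact mul_le_mul_of_nonneg_right
            (mul_le_mul_of_nonneg_left (hstep i hi) (hc i)) (pow_nonneg (hU0 i) k)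
      _ = (s - k - 1) * ∑ l ∈ F, c l * D l ^ (s - k - 1 - 1) *
            ∑ i ∈ F with Q l ⊆ Q i, c i * U i ^ k := by
          simp only [Finset.sum_filter, Finset.mul_sum, Finset.sum_mul]
          rw [Finset.sum_comm]
          refine Finset.sum_congr rfl fun l _ => Finset.sum_congr rfl fun i _ => ?_
          split_ifs <;> ring
      _ ≤ (s - k - 1) * ∑ l ∈ F, c l * D l ^ (s - k - 1 - 1) * U l ^ (k + 1) := by
          refine mul_le_mul_of_nonneg_left (Finset.sum_le_sum fun l _ => ?_) (by linarith)
          refine mul_le_mul_of_nonneg_left ?_ (mul_nonneg (hc l) (Real.rpow_nonneg (hD0 l) _))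
          rw [pow_succ', Finset.sum_mul]
          refine Finset.sum_le_sum fun i hi => mul_le_mul_of_nonneg_left ?_ (hc i)
          refine pow_le_pow_left₀ (hU0 i) ?_ k
          refine Finset.sum_le_sum_of_subset_of_nonneg (fun j hj => ?_) fun j _ _ => hc j
          rw [Finset.mem_filter] at hi hj ⊢
          exact ⟨hj.1, hi.2.trans hj.2⟩
      _ = _ := by
          push_cast
          have h1 : s - ((k : ℝ) + 1) = s - k - 1 := by ring
          rw [h1]

lemma sum_mul_indicator_eq_sum_filter {Ω ι : Type*} {Q : ι → Set Ω} {G : Finset ι} (x : Ω)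
    (d : ι → ℝ) :
    ∑ i ∈ G, d i * (Q i).indicator 1 x = ∑ i ∈ G with x ∈ Q i, d i := by
  rw [Finset.sum_filter]
  refine Finset.sum_congr rfl fun i _ => ?_
  by_cases h : x ∈ Q i <;> simp [h]

section Nested

variable {Ω ι : Type*} [MeasurableSpace Ω] {μ : Measure Ω} [IsFiniteMeasure μ]
  {Q : ι → Set Ω} {c : ι → ℝ}

lemma integrable_rpow_sum_mul_indicator (hQ : ∀ i, MeasurableSet (Q i)) (hc : ∀ i, 0 ≤ c i)
    (F : Finset ι) {p : ℝ} (hp : 0 ≤ p) :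
    Integrable (fun x => (∑ i ∈ F, c i * (Q i).indicator 1 x) ^ p) μ := by
  have hmeas : Measurable fun x => (∑ i ∈ F, c i * (Q i).indicator (1 : Ω → ℝ) x) ^ p :=
    (Finset.measurable_fun_sum F fun i _ =>
      (measurable_one.indicator (hQ i)).const_mul (c i)).pow_const p
  refine Integrable.of_bound hmeas.aestronglyMeasurable ((∑ i ∈ F, c i) ^ p)
    (ae_of_all _ fun x => ?_)
  have hnonneg : 0 ≤ ∑ i ∈ F, c i * (Q i).indicator (1 : Ω → ℝ) x :=
    Finset.sum_nonneg fun i _ => mul_nonneg (hc i) (Set.indicator_nonneg (by simp) x)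
  rw [Real.norm_of_nonneg (Real.rpow_nonneg hnonneg p)]
  refine Real.rpow_le_rpow hnonneg (Finset.sum_le_sum fun i _ => ?_) hp
  exact mul_le_of_le_one_right (hc i) (Set.indicator_le_self' (by simp) x)

lemma integral_sum_mul_indicator (hQ : ∀ i, MeasurableSet (Q i)) (F : Finset ι) :
    ∫ x, ∑ i ∈ F, c i * (Q i).indicator 1 x ∂μ = ∑ i ∈ F, c i * μ.real (Q i) := by
  have hint : ∀ i ∈ F, Integrable (fun x => c i * (Q i).indicator 1 x) μ := fun i _ =>
    ((integrable_const (1 : ℝ)).indicator (hQ i)).const_mul (c i)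
  rw [integral_finsetSum F hint]
  refine Finset.sum_congr rfl fun i _ => ?_
  rw [integral_const_mul, integral_indicator_one (hQ i)]

/-- Jensen's inequality for the sum of weights over the sets contained in `Q i`. -/
lemma setIntegral_rpow_sum_le (hQ : ∀ i, MeasurableSet (Q i)) (hc : ∀ i, 0 ≤ c i)
    {θ : ℝ} (hθ0 : 0 ≤ θ) (hθ1 : θ ≤ 1) (i : ι) (F : Finset ι) (hF : ∀ j ∈ F, Q j ⊆ Q i) :
    ∫ x in Q i, (∑ j ∈ F, c j * (Q j).indicator 1 x) ^ θ ∂μ ≤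
      μ.real (Q i) * (1 / μ.real (Q i) * ∑ j ∈ F, c j * μ.real (Q j)) ^ θ := by
  by_cases h0 : μ (Q i) = 0
  · rw [setIntegral_measure_zero _ h0, measureReal_def, h0]
    simp
  have hpos : 0 < μ.real (Q i) := ENNReal.toReal_pos h0 (measure_ne_top _ _)
  have hint1 := (integrable_rpow_sum_mul_indicator (μ := μ) hQ hc F zero_le_one)
  simp only [Real.rpow_one] at hint1
  have hjensen := (Real.concaveOn_rpow hθ0 hθ1).le_map_set_average (μ := μ) (t := Q i)
    (f := fun x => ∑ j ∈ F, c j * (Q j).indicator 1 x)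
    (Real.continuous_rpow_const hθ0).continuousOn isClosed_Ici h0 (measure_ne_top _ _)
    (ae_of_all _ fun x => Finset.sum_nonneg fun j _ =>
      mul_nonneg (hc j) (Set.indicator_nonneg (by simp) x))
    hint1.integrableOn (integrable_rpow_sum_mul_indicator hQ hc F hθ0).integrableOn
  rw [setAverage_eq, setAverage_eq, integral_sum_mul_indicator hQ] at hjensen
  have hsum : ∑ j ∈ F, c j * (μ.restrict (Q i)).real (Q j) = ∑ j ∈ F, c j * μ.real (Q j) := by
    refine Finset.sum_congr rfl fun j hj => ?_
    rw [measureReal_def, measureReal_def, Measure.restrict_eq_self μ (hF j hj)]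
  rw [hsum, smul_eq_mul, smul_eq_mul, inv_mul_le_iff₀ hpos] at hjensen
  rwa [one_div]

variable [Fintype ι]

lemma integral_rpow_sum_le_prod_mul (hQ : ∀ i, MeasurableSet (Q i)) (hc : ∀ i, 0 ≤ c i)
    (hnest : ∀ i j x, x ∈ Q i → x ∈ Q j → Q i ⊆ Q j ∨ Q j ⊆ Q i)
    {s : ℝ} (k : ℕ) (hk : k + 1 ≤ s) (hk' : s ≤ k + 2) :
    ∫ x, (∑ i, c i * (Q i).indicator 1 x) ^ s ∂μ ≤
      (∏ j ∈ Finset.range (k + 1), (s - j)) *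
        ∑ i, c i * μ.real (Q i) *
          (1 / μ.real (Q i) * ∑ j with Q j ⊆ Q i, c j * μ.real (Q j)) ^ (s - k - 1) *
          (∑ j with Q i ⊆ Q j, c j) ^ k := by
  have hprod : 0 ≤ ∏ j ∈ Finset.range (k + 1), (s - j) := Finset.prod_nonneg fun j hj => by
    have : (j : ℝ) ≤ k := by exact_mod_cast Nat.lt_succ_iff.1 (Finset.mem_range.1 hj)
    linarith
  set U : ι → ℝ := fun i => ∑ j with Q i ⊆ Q j, c j with hU
  have hU0 : ∀ i, 0 ≤ U i := fun i => Finset.sum_nonneg fun j _ => hc j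
  set g : ι → Ω → ℝ := fun i x =>
    (∑ j with Q j ⊆ Q i, c j * (Q j).indicator 1 x) ^ (s - k - 1) with hg
  have hgint : ∀ i, Integrable (g i) μ := fun i =>
    integrable_rpow_sum_mul_indicator hQ hc _ (by linarith)
  have hpt : ∀ x, (∑ i, c i * (Q i).indicator 1 x) ^ s ≤
      (∏ j ∈ Finset.range (k + 1), (s - j)) *
        ∑ i, c i * U i ^ k * (Q i).indicator (g i) x := by
    intro x
    rw [sum_mul_indicator_eq_sum_filter]
    refine (rpow_sum_le_prod_mul_of_chain Q hc k hk _ fun i hi j hj =>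
      hnest i j x (Finset.mem_filter.1 hi).2 (Finset.mem_filter.1 hj).2).trans_eq ?_
    congr 1
    rw [Finset.sum_filter]
    refine Finset.sum_congr rfl fun i _ => ?_
    by_cases hx : x ∈ Q i
    · have hup : ((Finset.univ.filter fun i => x ∈ Q i).filter fun j => Q i ⊆ Q j) =
          Finset.univ.filter fun j => Q i ⊆ Q j := by
        ext j
        simpa using fun h : Q i ⊆ Q j => h hx
      rw [if_pos hx, Set.indicator_of_mem hx, hup, hg]
      simp only
      rw [sum_mul_indicator_eq_sum_filter, Finset.filter_comm]
      ring
    · simp [hx]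
  have hint : ∀ i ∈ (Finset.univ : Finset ι),
      Integrable (fun x => c i * U i ^ k * (Q i).indicator (g i) x) μ := fun i _ =>
    ((hgint i).indicator (hQ i)).const_mul _
  refine (integral_mono (integrable_rpow_sum_mul_indicator hQ hc _ (by linarith))
    ((integrable_finsetSum _ hint).const_mul _) hpt).trans ?_
  rw [integral_const_mul, integral_finsetSum _ hint]
  refine mul_le_mul_of_nonneg_left (Finset.sum_le_sum fun i _ => ?_) hprod
  rw [integral_const_mul, integral_indicator (hQ i)]
  refine (mul_le_mul_of_nonneg_left (setIntegral_rpow_sum_le hQ hc (by linarith) (by linarith) i _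
    fun j hj => (Finset.mem_filter.1 hj).2) (mul_nonneg (hc i) (pow_nonneg (hU0 i) k))).trans_eq ?_
  ring

lemma sum_mul_rpow_le_integral (hQ : ∀ i, MeasurableSet (Q i)) (hc : ∀ i, 0 ≤ c i)
    {p : ℝ} (hp : 0 ≤ p) :
    ∑ i, c i * μ.real (Q i) * (∑ j with Q i ⊆ Q j, c j) ^ p ≤
      ∫ x, (∑ i, c i * (Q i).indicator 1 x) ^ (p + 1) ∂μ := by
  set U : ι → ℝ := fun i => ∑ j with Q i ⊆ Q j, c j with hU
  have hU0 : ∀ i, 0 ≤ U i := fun i => Finset.sum_nonneg fun j _ => hc j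
  have hint : Integrable (fun x => ∑ i, c i * U i ^ p * (Q i).indicator 1 x) μ :=
    integrable_finsetSum _ fun i _ => ((integrable_const (1 : ℝ)).indicator (hQ i)).const_mul _
  have hcalc : ∑ i, c i * μ.real (Q i) * U i ^ p =
      ∫ x, ∑ i, c i * U i ^ p * (Q i).indicator 1 x ∂μ := by
    rw [integral_sum_mul_indicator hQ]
    exact Finset.sum_congr rfl fun i _ => by ring
  rw [hcalc]
  refine integral_mono hint
    (integrable_rpow_sum_mul_indicator hQ hc _ (by linarith)) fun x => ?_
  simp only [sum_mul_indicator_eq_sum_filter]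
  rw [Real.rpow_add_one' (Finset.sum_nonneg fun i _ => hc i) (by linarith), mul_comm,
    Finset.sum_mul]
  refine Finset.sum_le_sum fun i hi => mul_le_mul_of_nonneg_left ?_ (hc i)
  refine Real.rpow_le_rpow (hU0 i) ?_ hp
  refine Finset.sum_le_sum_of_subset_of_nonneg (fun j hj => ?_) fun j _ _ => hc j
  simp only [Finset.mem_filter, Finset.mem_univ, true_and] at hi hj ⊢
  exact hj hi

end Nested

lemma sum_mul_rpow_mul_pow_le {ι : Type*} (F : Finset ι) {a T U : ι → ℝ} (ha : ∀ i, 0 ≤ a i)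
    (hT : ∀ i, 0 ≤ T i) (hU : ∀ i, 0 ≤ U i) {θ : ℝ} (hθ : 0 < θ) {k : ℕ} (hk : 0 < k) :
    ∑ i ∈ F, a i * T i ^ θ * U i ^ k ≤
      (∑ i ∈ F, a i * U i ^ (θ + k)) ^ (k / (θ + k)) *
        (∑ i ∈ F, a i * T i ^ (θ + k)) ^ (θ / (θ + k)) := by
  have hk' : (0 : ℝ) < k := by exact_mod_cast hk
  have hr : 0 < θ + k := by positivity
  have hpq : Real.HolderConjugate ((θ + k) / k) ((θ + k) / θ) := by
    rw [Real.holderConjugate_iff]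
    constructor
    · rw [lt_div_iff₀ hk']
      linarith
    · field_simp
      ring
  have hpow : ∀ (i : ι) (y t : ℝ), 0 ≤ y → 0 < t →
      (a i ^ (t / (θ + k)) * y ^ t) ^ ((θ + k) / t) = a i * y ^ (θ + k) := by
    intro i y t hy ht
    rw [Real.mul_rpow (Real.rpow_nonneg (ha i) _) (Real.rpow_nonneg hy _), ← Real.rpow_mul (ha i),
      ← Real.rpow_mul hy]
    have h1 : t / (θ + k) * ((θ + k) / t) = 1 := by field_simp
    have h2 : t * ((θ + k) / t) = θ + k := by field_simp
    rw [h1, h2, Real.rpow_one]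
  have hholder := Real.inner_le_Lp_mul_Lq_of_nonneg F hpq
    (f := fun i => a i ^ ((k : ℝ) / (θ + k)) * U i ^ (k : ℝ))
    (g := fun i => a i ^ (θ / (θ + k)) * T i ^ θ)
    (fun i _ => mul_nonneg (Real.rpow_nonneg (ha i) _) (Real.rpow_nonneg (hU i) _))
    (fun i _ => mul_nonneg (Real.rpow_nonneg (ha i) _) (Real.rpow_nonneg (hT i) _))
  simp only [hpow _ _ _ (hU _) hk', hpow _ _ _ (hT _) hθ, one_div_div] at hholder
  refine le_trans (le_of_eq (Finset.sum_congr rfl fun i _ => ?_)) hholder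
  have h1 : a i = a i ^ ((k : ℝ) / (θ + k)) * a i ^ (θ / (θ + k)) := by
    rw [← Real.rpow_add_of_nonneg (ha i) (by positivity) (by positivity)]
    have : (k : ℝ) / (θ + k) + θ / (θ + k) = 1 := by field_simp; ring
    rw [this, Real.rpow_one]
  rw [Real.rpow_natCast]
  nth_rewrite 1 [h1]
  ring

lemma le_rpow_mul_of_le_mul_rpow_mul_rpow {A B C u v : ℝ} (hA : 0 ≤ A) (hB : 0 ≤ B) (hC : 0 ≤ C)
    (hv : 0 < v) (huv : u + v = 1) (h : A ≤ C * A ^ u * B ^ v) : A ≤ C ^ (1 / v) * B := by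
  rcases hA.eq_or_lt with rfl | hA'
  · positivity
  have hu : 0 < A ^ u := Real.rpow_pos_of_pos hA' u
  have hAv : A ^ v ≤ C * B ^ v := by
    have hsplit : A = A ^ u * A ^ v := by rw [← Real.rpow_add hA', huv, Real.rpow_one]
    refine le_of_mul_le_mul_left ?_ hu
    rw [← hsplit]
    linarith
  have hfinal := Real.rpow_le_rpow (Real.rpow_nonneg hA v) hAv (by positivity : 0 ≤ 1 / v)
  rwa [Real.mul_rpow hC (Real.rpow_nonneg hB v), ← Real.rpow_mul hA, ← Real.rpow_mul hB,
    mul_one_div_cancel hv.ne', Real.rpow_one, Real.rpow_one] at hfinal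

lemma measurableSet_dyadicCube (n : ℕ) (i : ℤ) (k : Fin n → ℤ) :
    MeasurableSet (dyadicCube n i k) := by
  have : dyadicCube n i k =
      Set.univ.pi fun j => Set.Ico ((k j : ℝ) * 2 ^ (-i)) (((k j : ℝ) + 1) * 2 ^ (-i)) := by
    ext x
    simp [dyadicCube]
  rw [this]
  exact MeasurableSet.univ_pi fun j => measurableSet_Ico

lemma dyadicCube_subset_of_le {n : ℕ} {i i' : ℤ} {k k' : Fin n → ℤ} (hi : i' ≤ i)
    {x : Fin n → ℝ} (hx : x ∈ dyadicCube n i k) (hx' : x ∈ dyadicCube n i' k') :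
    dyadicCube n i k ⊆ dyadicCube n i' k' := by
  obtain ⟨d, rfl⟩ := Int.le.dest hi
  intro y hy j
  obtain ⟨hxl, hxr⟩ := hx j
  obtain ⟨hxl', hxr'⟩ := hx' j
  obtain ⟨hyl, hyr⟩ := hy j
  have hpos : (0 : ℝ) < 2 ^ (-(i' + d)) := by positivity
  have hscale : (2 : ℝ) ^ (-i') = 2 ^ d * 2 ^ (-(i' + d)) := by
    rw [← zpow_natCast, ← zpow_add₀ two_ne_zero]
    congr 1
    ring
  rw [hscale, ← mul_assoc] at hxl' hxr' ⊢
  rw [← mul_assoc]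
  have hlow : k' j * 2 ^ d ≤ k j := by
    have : (k' j : ℝ) * 2 ^ d < k j + 1 := lt_of_mul_lt_mul_right (hxl'.trans_lt hxr) hpos.le
    exact Int.lt_add_one_iff.1 (by exact_mod_cast this)
  have hhigh : k j + 1 ≤ (k' j + 1) * 2 ^ d := by
    have : (k j : ℝ) < (k' j + 1) * 2 ^ d := lt_of_mul_lt_mul_right (hxl.trans_lt hxr') hpos.le
    exact Int.add_one_le_iff.2 (by exact_mod_cast this)
  have hlow' : (k' j : ℝ) * 2 ^ d ≤ k j := by exact_mod_cast hlow
  have hhigh' : (k j : ℝ) + 1 ≤ (k' j + 1) * 2 ^ d := by exact_mod_cast hhigh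
  exact ⟨(mul_le_mul_of_nonneg_right hlow' hpos.le).trans hyl,
    hyr.trans_le (mul_le_mul_of_nonneg_right hhigh' hpos.le)⟩

lemma IsDyadicCube.measurableSet {n : ℕ} {E : Set (Fin n → ℝ)} (hE : IsDyadicCube n E) :
    MeasurableSet E := by
  obtain ⟨i, k, rfl⟩ := hE
  exact measurableSet_dyadicCube n i k

lemma IsDyadicCube.subset_or_subset {n : ℕ} {E E' : Set (Fin n → ℝ)} (hE : IsDyadicCube n E)
    (hE' : IsDyadicCube n E') {x : Fin n → ℝ} (hx : x ∈ E) (hx' : x ∈ E') :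
    E ⊆ E' ∨ E' ⊆ E := by
  obtain ⟨i, k, rfl⟩ := hE
  obtain ⟨i', k', rfl⟩ := hE'
  rcases le_total i' i with h | h
  · exact Or.inl (dyadicCube_subset_of_le h hx hx')
  · exact Or.inr (dyadicCube_subset_of_le h hx' hx)

theorem wolff_lemma_A1_le_A2_large_exponent (n : ℕ) (σ : Measure (Fin n → ℝ))
    [IsFiniteMeasure σ] (s : ℝ) (hs : 2 < s) {ι : Type*} [Fintype ι]
    (Q : ι → Set (Fin n → ℝ)) (Q₀ : Set (Fin n → ℝ))
    (hQ₀ : IsDyadicCube n Q₀) (hQ : ∀ i, IsDyadicCube n (Q i))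
    (hsub : ∀ i, Q i ⊆ Q₀) (α : ι → ℝ) (hα : ∀ i, 0 ≤ α i)
    (hpos : ∀ i, α i ≠ 0 → 0 < (σ (Q i)).toReal) :
    (∫ x in Q₀, (∑ i, α i / (σ (Q i)).toReal * (Q i).indicator 1 x) ^ s ∂σ) ≤
        (∏ j ∈ Finset.range ((⌈s - 2⌉).toNat + 1), (s - j)) *
          (∫ x in Q₀, (∑ i, α i / (σ (Q i)).toReal * (Q i).indicator 1 x) ^ s ∂σ) ^
            (((⌈s - 2⌉).toNat : ℝ) / (s - 1)) *
          (∑ i, α i * ((1 / (σ (Q i)).toReal) *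
              ∑ j ∈ Finset.univ.filter fun j => Q j ⊆ Q i, α j) ^ (s - 1)) ^
            ((s - (⌈s - 2⌉).toNat - 1) / (s - 1)) ∧
    (∫ x in Q₀, (∑ i, α i / (σ (Q i)).toReal * (Q i).indicator 1 x) ^ s ∂σ) ≤
      ((∏ j ∈ Finset.range ((⌈s - 2⌉).toNat + 1), (s - j)) ^
          ((s - 1) / (s - (⌈s - 2⌉).toNat - 1))) *
        ∑ i, α i * ((1 / (σ (Q i)).toReal) *
          ∑ j ∈ Finset.univ.filter fun j => Q j ⊆ Q i, α j) ^ (s - 1) := by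
  obtain ⟨k, hk⟩ : ∃ k : ℕ, (k : ℤ) = ⌈s - 2⌉ :=
    ⟨_, Int.toNat_of_nonneg (Int.ceil_nonneg (by linarith))⟩
  have hkR : (k : ℝ) = (⌈s - 2⌉ : ℝ) := by exact_mod_cast hk
  have hk_ge : s ≤ k + 2 := by linarith [Int.le_ceil (s - 2)]
  have hk_lt : (k : ℝ) + 1 < s := by linarith [Int.ceil_lt_add_one (s - 2)]
  have hk_pos : 0 < k := by
    have : (0 : ℝ) < k := by linarith
    exact_mod_cast this
  rw [← hk, Int.toNat_natCast]
  set m : ι → ℝ := fun i => (σ (Q i)).toReal with hm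
  set c : ι → ℝ := fun i => α i / m i with hc_def
  have hc : ∀ i, 0 ≤ c i := fun i => div_nonneg (hα i) ENNReal.toReal_nonneg
  have hcm : ∀ i, c i * m i = α i := fun i => by
    by_cases h : α i = 0
    · simp [hc_def, h]
    · exact div_mul_cancel₀ _ (hpos i h).ne'
  have hreal : ∀ i, (σ.restrict Q₀).real (Q i) = m i := fun i => by
    rw [measureReal_def, Measure.restrict_eq_self σ (hsub i)]
  have hmeas : ∀ i, MeasurableSet (Q i) := fun i => (hQ i).measurableSet
  have hmain := integral_rpow_sum_le_prod_mul (μ := σ.restrict Q₀) hmeas hc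
    (fun i j x hi hj => (hQ i).subset_or_subset (hQ j) hi hj) k hk_lt.le hk_ge
  have hup := sum_mul_rpow_le_integral (μ := σ.restrict Q₀) hmeas hc
    (by linarith : (0 : ℝ) ≤ s - 1)
  simp only [hreal, hcm, sub_add_cancel] at hmain hup
  set A₁ := ∫ x in Q₀, (∑ i, c i * (Q i).indicator 1 x) ^ s ∂σ
  set T : ι → ℝ := fun i => 1 / m i * ∑ j with Q j ⊆ Q i, α j with hT_def
  set C := ∏ j ∈ Finset.range (k + 1), (s - (j : ℝ))
  have hT : ∀ i, 0 ≤ T i := fun i =>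
    mul_nonneg (one_div_nonneg.2 ENNReal.toReal_nonneg) (Finset.sum_nonneg fun j _ => hα j)
  have hU : ∀ i, 0 ≤ ∑ j with Q i ⊆ Q j, c j := fun i => Finset.sum_nonneg fun j _ => hc j
  have hC : 0 ≤ C := Finset.prod_nonneg fun j hj => by
    have : (j : ℝ) ≤ k := by exact_mod_cast Nat.lt_succ_iff.1 (Finset.mem_range.1 hj)
    linarith
  have hA₁ : 0 ≤ A₁ := (Finset.sum_nonneg fun i _ =>
    mul_nonneg (hα i) (Real.rpow_nonneg (hU i) _)).trans hup
  have hA₂ : 0 ≤ ∑ i, α i * T i ^ (s - 1) :=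
    Finset.sum_nonneg fun i _ => mul_nonneg (hα i) (Real.rpow_nonneg (hT i) _)
  have hholder := sum_mul_rpow_mul_pow_le Finset.univ hα hT hU
    (by linarith : 0 < s - k - 1) hk_pos
  rw [show s - k - 1 + k = s - 1 by ring] at hholder
  have hfirst : A₁ ≤ C * A₁ ^ ((k : ℝ) / (s - 1)) *
      (∑ i, α i * T i ^ (s - 1)) ^ ((s - k - 1) / (s - 1)) := by
    rw [mul_assoc]
    refine hmain.trans (mul_le_mul_of_nonneg_left (hholder.trans ?_) hC)
    refine mul_le_mul_of_nonneg_right ?_ (Real.rpow_nonneg hA₂ _)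
    exact Real.rpow_le_rpow (Finset.sum_nonneg fun i _ =>
      mul_nonneg (hα i) (Real.rpow_nonneg (hU i) _)) hup
      (div_nonneg (Nat.cast_nonneg k) (by linarith))
  refine ⟨hfirst, ?_⟩
  have hs1 : s - 1 ≠ 0 := by linarith
  have hsecond := le_rpow_mul_of_le_mul_rpow_mul_rpow hA₁ hA₂ hC
    (div_pos (by linarith) (by linarith) : 0 < (s - k - 1) / (s - 1))
    (by field_simp; ring) hfirst
  rwa [one_div_div] at hsecond

end
end

section
/- Let σ, ω be nonnegative locally finite Borel measures on ℝ^n and K : D → [0,∞). For 1 < q < p < ∞ with 1/q = 1/r + 1/p, the two-weight trace inequality ‖T_K[f dσ]‖_{L^q(dω)} ≤ C_1 ‖f‖_{L^p(dσ)} (for all f ∈ L^p(dσ)) holds if and only if both ‖(W^q_{K,ω}[σ])^{1/q}‖_{L^r(dσ)} < ∞ and ‖(W^{p'}_{K,σ}[ω])^{1/p'}‖_{L^r(dω)} < ∞; moreover the least constant C_1 is comparable (with constants depending only on p, q, n) to C_2 = max of these two Wolff-potential norms. -/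
open MeasureTheory ENNReal Classical

noncomputable section

def cube (n : ℕ) (P : ℤ × (Fin n → ℤ)) : Set (Fin n → ℝ) := dyadicCube n P.1 P.2

/-- `K̄_μ(Q)` (zero when `μ(Q)=0`, via the `ℝ≥0∞` conventions and the factor `μ(Q)` below). -/
def Kbar (n : ℕ) (K : ℤ × (Fin n → ℤ) → ℝ≥0∞) (μ : Measure (Fin n → ℝ))
    (P : ℤ × (Fin n → ℤ)) (x : Fin n → ℝ) : ℝ≥0∞ :=
  (∑' P' : ℤ × (Fin n → ℤ),
    if cube n P' ⊆ cube n P then (cube n P').indicator (fun _ => K P' * μ (cube n P')) x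
    else 0) / μ (cube n P)

/-- The discrete Wolff potential `W^s_{K,μ}[ν]`. -/
def wolff (n : ℕ) (K : ℤ × (Fin n → ℤ) → ℝ≥0∞) (μ ν : Measure (Fin n → ℝ))
    (s : ℝ) (x : Fin n → ℝ) : ℝ≥0∞ :=
  ∑' P : ℤ × (Fin n → ℤ), (cube n P).indicator
    (fun _ => K P * μ (cube n P) * (∫⁻ y in cube n P, Kbar n K μ P y ∂ν) ^ (s - 1)) x

/-- The positive dyadic operator `T_K[f dσ] = ∑_Q K(Q) (∫_Q f dσ) 1_Q`. -/
def dyadicOp (n : ℕ) (K : ℤ × (Fin n → ℤ) → ℝ≥0∞) (σ : Measure (Fin n → ℝ))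
    (f : (Fin n → ℝ) → ℝ≥0∞) (x : Fin n → ℝ) : ℝ≥0∞ :=
  ∑' P : ℤ × (Fin n → ℤ),
    (cube n P).indicator (fun _ => K P * ∫⁻ y in cube n P, f y ∂σ) x

/-! ### Dyadic powers -/

lemma dyadic_zpow_pos (k : ℤ) : (0 : ℝ≥0∞) < 2 ^ k :=
  ENNReal.zpow_pos (by norm_num) (by norm_num) k

lemma dyadic_zpow_ne_top (k : ℤ) : (2 : ℝ≥0∞) ^ k ≠ ⊤ :=
  ENNReal.zpow_ne_top (by norm_num) (by norm_num) k

lemma dyadic_zpow_le_iff {k l : ℤ} : (2 : ℝ≥0∞) ^ k ≤ 2 ^ l ↔ k ≤ l := by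
  refine ⟨fun h => ?_, fun h => ENNReal.zpow_le_of_le (by norm_num) h⟩
  by_contra! hlt
  have h1 : (2 : ℝ≥0∞) ^ (l + 1) ≤ 2 ^ l :=
    (ENNReal.zpow_le_of_le (by norm_num) (by omega)).trans h
  rw [ENNReal.zpow_add (by norm_num) (by norm_num), zpow_one, mul_two] at h1
  exact absurd h1 (not_le.2 (ENNReal.lt_add_right (dyadic_zpow_ne_top l) (dyadic_zpow_pos l).ne'))

/-- The sum of a geometric series with ratio `2 ^ (-s)`. -/
def geomConst (s : ℝ) : ℝ≥0∞ := (1 - 2 ^ (-s))⁻¹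

lemma geomConst_ne_top {s : ℝ} (hs : 0 < s) : geomConst s ≠ ⊤ := by
  rw [geomConst, ENNReal.inv_ne_top]
  refine (tsub_pos_of_lt ?_).ne'
  exact ENNReal.rpow_lt_one_of_one_lt_of_neg (by norm_num) (by linarith)

lemma tsum_dyadic_rpow_le {s : ℝ} (hs : 0 < s) (b : ℝ≥0∞) :
    ∑' k : ℤ, (if (2 : ℝ≥0∞) ^ k ≤ b then ((2 : ℝ≥0∞) ^ k) ^ s else 0) ≤ geomConst s * b ^ s := by
  rcases eq_or_ne b 0 with rfl | hb0
  · simp [(dyadic_zpow_pos _).ne']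
  rcases eq_or_ne b ⊤ with rfl | hbt
  · have : geomConst s ≠ 0 := by
      rw [geomConst, ENNReal.inv_ne_zero]
      exact (tsub_le_self.trans_lt ENNReal.one_lt_top).ne
    rw [ENNReal.top_rpow_of_pos hs, ENNReal.mul_top this]
    exact le_top
  obtain ⟨l, hl1, hl2⟩ := ENNReal.exists_mem_Ico_zpow hb0 hbt (y := 2) (by norm_num) (by norm_num)
  have hle : ∀ k : ℤ, (2 : ℝ≥0∞) ^ k ≤ b → k ≤ l := by
    intro k hk
    by_contra! h
    exact absurd (hk.trans_lt hl2) (not_lt.2 (dyadic_zpow_le_iff.2 (by omega)))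
  have hinj : Function.Injective (fun n : ℕ => l - (n : ℤ)) := fun a b h => by
    simp only at h; omega
  rw [← hinj.tsum_eq]
  · calc _ ≤ ∑' n : ℕ, ((2 : ℝ≥0∞) ^ (-s)) ^ n * b ^ s := by
          refine ENNReal.tsum_le_tsum fun n => ?_
          split_ifs with h
          · calc ((2 : ℝ≥0∞) ^ (l - (n : ℤ))) ^ s
                = ((2 : ℝ≥0∞) ^ (-s)) ^ n * ((2 : ℝ≥0∞) ^ l) ^ s := by
                  simp only [← ENNReal.rpow_intCast, ← ENNReal.rpow_natCast, ← ENNReal.rpow_mul]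
                  rw [← ENNReal.rpow_add _ _ (by norm_num) (by norm_num)]
                  congr 1
                  push_cast
                  ring
              _ ≤ _ := by gcongr
          · exact zero_le
      _ = _ := by rw [ENNReal.tsum_mul_right, ENNReal.tsum_geometric, geomConst]
  · intro k hk
    have hk' : (2 : ℝ≥0∞) ^ k ≤ b := by
      by_contra h
      simp [h] at hk
    exact ⟨(l - k).toNat, by have := hle k hk'; simp only; omega⟩

lemma rpow_le_tsum_dyadic {p : ℝ} (hp : 0 < p) (a : ℝ≥0∞) :
    a ^ p ≤ 2 ^ p * ∑' k : ℤ, (if (2 : ℝ≥0∞) ^ k < a then ((2 : ℝ≥0∞) ^ k) ^ p else 0) := by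
  rcases eq_or_ne a 0 with rfl | ha0
  · simp [ENNReal.zero_rpow_of_pos hp]
  rcases eq_or_ne a ⊤ with rfl | hat
  · have hsum : ∑' k : ℤ, (if (2 : ℝ≥0∞) ^ k < ⊤ then ((2 : ℝ≥0∞) ^ k) ^ p else 0) = ⊤ := by
      refine top_le_iff.1 ((ENNReal.tsum_const_eq_top_of_ne_zero (α := ℕ) (c := 1)
        one_ne_zero).symm.le.trans (le_trans ?_ (ENNReal.tsum_comp_le_tsum_of_injective
        (f := fun n : ℕ => (n : ℤ)) Nat.cast_injective _)))
      refine ENNReal.tsum_le_tsum fun n => ?_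
      rw [if_pos (lt_top_iff_ne_top.2 (dyadic_zpow_ne_top _))]
      refine ENNReal.one_le_rpow ?_ hp
      simpa using dyadic_zpow_le_iff.2 (Int.natCast_nonneg n)
    rw [hsum, ENNReal.mul_top]
    · exact le_top
    · exact (ENNReal.rpow_pos (by norm_num) (by norm_num)).ne'
  obtain ⟨l, hl1, hl2⟩ := ENNReal.exists_mem_Ioc_zpow ha0 hat (y := 2) (by norm_num) (by norm_num)
  refine le_trans ?_ (mul_le_mul_right (ENNReal.le_tsum l) _)
  rw [if_pos hl1, ← ENNReal.mul_rpow_of_nonneg _ _ hp.le]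
  gcongr
  rwa [ENNReal.zpow_add (by norm_num) (by norm_num), zpow_one, mul_comm] at hl2

lemma rpow_eq_rpow_sub_one_mul {p : ℝ} (hp : 1 ≤ p) (x : ℝ≥0∞) : x ^ p = x ^ (p - 1) * x := by
  nth_rewrite 3 [← ENNReal.rpow_one x]
  rw [← ENNReal.rpow_add_of_nonneg _ _ (by linarith) zero_le_one, sub_add_cancel]

/-! ### Converse of Hölder's inequality -/

section Laminar

variable {α ι : Type*} [MeasurableSpace α]

lemma lintegral_rpow_le_of_forall_mul_le (μ : Measure α) [SigmaFinite μ] {s t : ℝ}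
    (hst : s.HolderConjugate t) {h : α → ℝ≥0∞} (hh : Measurable h) {C : ℝ≥0∞}
    (H : ∀ g : α → ℝ≥0∞, Measurable g → ∫⁻ x, g x ^ t ∂μ ≠ ⊤ →
      ∫⁻ x, h x * g x ∂μ ≤ C * (∫⁻ x, g x ^ t ∂μ) ^ (1 / t)) :
    (∫⁻ x, h x ^ s ∂μ) ^ (1 / s) ≤ C := by
  have hs := hst.pos
  have ht := hst.symm.pos
  set u : ℕ → α → ℝ≥0∞ := fun n => (spanningSets μ n).indicator (fun x => min (h x) n) with hu
  have hum : ∀ n, Measurable (u n) := fun n =>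
    (hh.min measurable_const).indicator (measurableSet_spanningSets μ n)
  have humono : Monotone u := by
    intro m n hmn x
    simp only [hu]
    refine (Set.indicator_le_indicator_of_subset (monotone_spanningSets μ hmn)
      (fun _ => zero_le) x).trans (Set.indicator_le_indicator ?_)
    gcongr
  have hule : ∀ n x, u n x ≤ h x := fun n x => by
    simp only [hu]
    exact Set.indicator_apply_le fun _ => min_le_left _ _
  have husup : ∀ x, ⨆ n, u n x = h x := by
    intro x
    refine le_antisymm (iSup_le fun n => hule n x) ?_
    refine le_of_forall_lt fun y hy => ?_
    obtain ⟨N, hN⟩ := Set.mem_iUnion.1 (iUnion_spanningSets μ ▸ Set.mem_univ x)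
    obtain ⟨N', hN'⟩ := ENNReal.exists_nat_gt (ne_top_of_lt hy)
    refine lt_of_lt_of_le ?_ (le_iSup _ (max N N'))
    simp only [hu]
    rw [Set.indicator_of_mem (monotone_spanningSets μ (le_max_left _ _) hN)]
    refine lt_min hy (hN'.trans_le ?_)
    exact_mod_cast le_max_right N N'
  have hfin : ∀ n, ∫⁻ x, u n x ^ s ∂μ ≠ ⊤ := by
    intro n
    have : ∀ x, u n x ^ s ≤ (spanningSets μ n).indicator (fun _ => (n : ℝ≥0∞) ^ s) x := by
      intro x
      simp only [hu]
      by_cases hx : x ∈ spanningSets μ n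
      · simp only [Set.indicator_of_mem hx]
        gcongr
        exact min_le_right _ _
      · simp [Set.indicator_of_notMem hx, ENNReal.zero_rpow_of_pos hs]
    refine ne_top_of_le_ne_top ?_ (lintegral_mono this)
    rw [lintegral_indicator_const (measurableSet_spanningSets μ n)]
    exact ENNReal.mul_ne_top (ENNReal.rpow_ne_top_of_nonneg hs.le (ENNReal.natCast_ne_top n))
      (measure_spanningSets_lt_top μ n).ne
  have key : ∀ n, ∫⁻ x, u n x ^ s ∂μ ≤ C ^ s := by
    intro n
    set I := ∫⁻ x, u n x ^ s ∂μ with hI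
    rcases eq_or_ne I 0 with h0 | h0
    · rw [h0]; exact zero_le
    have hpow : ∀ x, (u n x ^ (s - 1)) ^ t = u n x ^ s := fun x => by
      rw [← ENNReal.rpow_mul, hst.sub_one_mul_conj]
    have h1 := H (fun x => u n x ^ (s - 1)) ((hum n).pow_const _) (by simpa only [hpow] using hfin n)
    simp only [hpow] at h1
    have h2 : I ≤ C * I ^ (1 / t) := by
      refine le_trans (lintegral_mono fun x => ?_) h1
      rw [rpow_eq_rpow_sub_one_mul hst.lt.le, mul_comm]
      gcongr
      exact hule n x
    have h3 : I ^ (1 / s) ≤ C := by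
      have e : I = I ^ (1 / s) * I ^ (1 / t) := by
        rw [← ENNReal.rpow_add _ _ h0 (hfin n), one_div, one_div, hst.inv_add_inv_eq_one,
          ENNReal.rpow_one]
      have h0' : I ^ (1 / t) ≠ 0 := (ENNReal.rpow_pos (pos_iff_ne_zero.2 h0) (hfin n)).ne'
      have ht' : I ^ (1 / t) ≠ ⊤ := ENNReal.rpow_ne_top_of_nonneg (by positivity) (hfin n)
      exact (ENNReal.mul_le_mul_iff_left h0' ht').1 (e.symm.trans_le h2)
    calc I = (I ^ (1 / s)) ^ s := by
          rw [← ENNReal.rpow_mul, one_div_mul_cancel hs.ne', ENNReal.rpow_one]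
      _ ≤ _ := by gcongr
  have hlim : ∫⁻ x, h x ^ s ∂μ = ⨆ n, ∫⁻ x, u n x ^ s ∂μ := by
    rw [← lintegral_iSup (fun n => (hum n).pow_const s)
      (fun m n hmn x => ENNReal.rpow_le_rpow (humono hmn x) hs.le)]
    refine lintegral_congr fun x => ?_
    rw [← husup x]
    exact (ENNReal.orderIsoRpow s hs).map_iSup _
  calc _ ≤ (C ^ s) ^ (1 / s) := by
        rw [hlim]
        gcongr
        exact iSup_le key
    _ = C := by rw [← ENNReal.rpow_mul, mul_one_div_cancel hs.ne', ENNReal.rpow_one]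

/-! ### Laminar families of sets -/

/-- A family of sets any two of which are nested or disjoint. -/
def IsLaminar {α ι : Type*} (c : ι → Set α) : Prop :=
  ∀ i j, c i ⊆ c j ∨ c j ⊆ c i ∨ Disjoint (c i) (c j)

lemma IsLaminar.exists_disjoint_cover {α ι : Type*} {c : ι → Set α} (hc : IsLaminar c) (B : Finset ι) :
    ∃ B' ⊆ B, (B' : Set ι).PairwiseDisjoint c ∧ ∀ i ∈ B, ∃ j ∈ B', c i ⊆ c j := by
  induction B using Finset.induction_on with
  | empty => exact ⟨∅, by simp⟩
  | insert i B hi ih =>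
    obtain ⟨B', hB', hd, hcov⟩ := ih
    by_cases h : ∃ j ∈ B', c i ⊆ c j
    · refine ⟨B', hB'.trans (Finset.subset_insert _ _), hd, fun k hk => ?_⟩
      rcases Finset.mem_insert.1 hk with rfl | hk
      · exact h
      · exact hcov k hk
    · push Not at h
      refine ⟨insert i (B'.filter fun j => ¬ c j ⊆ c i), ?_, ?_, ?_⟩
      · exact Finset.insert_subset_insert _ ((Finset.filter_subset _ _).trans hB')
      · rw [Finset.coe_insert, Set.pairwiseDisjoint_insert]
        refine ⟨hd.subset fun j hj => (Finset.mem_filter.1 hj).1, fun j hj _ => ?_⟩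
        obtain ⟨hj1, hj2⟩ := Finset.mem_filter.1 hj
        exact ((hc i j).resolve_left (h j hj1)).resolve_left hj2
      · intro k hk
        rcases Finset.mem_insert.1 hk with rfl | hk
        · exact ⟨k, Finset.mem_insert_self _ _, subset_rfl⟩
        · obtain ⟨j, hj, hkj⟩ := hcov k hk
          by_cases hji : c j ⊆ c i
          · exact ⟨i, Finset.mem_insert_self _ _, hkj.trans hji⟩
          · exact ⟨j, Finset.mem_insert_of_mem (Finset.mem_filter.2 ⟨hj, hji⟩), hkj⟩

/-- The average of `f` over a set. -/
def avg (μ : Measure α) (f : α → ℝ≥0∞) (s : Set α) : ℝ≥0∞ := (∫⁻ x in s, f x ∂μ) / μ s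

/-- The maximal function associated with a family of sets. -/
def maxFn (c : ι → Set α) (μ : Measure α) (f : α → ℝ≥0∞) (x : α) : ℝ≥0∞ :=
  ⨆ i, (c i).indicator (fun _ => avg μ f (c i)) x

lemma avg_mul_measure {μ : Measure α} (f : α → ℝ≥0∞) {s : Set α} (hs : μ s ≠ ⊤) :
    avg μ f s * μ s = ∫⁻ x in s, f x ∂μ := by
  rcases eq_or_ne (μ s) 0 with h | h
  · rw [h, mul_zero, setLIntegral_measure_zero _ _ h]
  · rw [avg, ENNReal.div_mul_cancel h hs]

lemma avg_le_maxFn {c : ι → Set α} {μ : Measure α} {f : α → ℝ≥0∞} {i : ι} {x : α} (hx : x ∈ c i) :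
    avg μ f (c i) ≤ maxFn c μ f x := by
  refine le_iSup_of_le i ?_
  rw [Set.indicator_of_mem hx]

lemma measurable_maxFn [Countable ι] {c : ι → Set α} (hm : ∀ i, MeasurableSet (c i)) (μ : Measure α)
    (f : α → ℝ≥0∞) : Measurable (maxFn c μ f) :=
  Measurable.iSup fun i => measurable_const.indicator (hm i)

lemma IsLaminar.mul_measure_maxFn_gt_le [Countable ι] {c : ι → Set α} (hc : IsLaminar c)
    (hm : ∀ i, MeasurableSet (c i)) {μ : Measure α} (hμ : ∀ i, μ (c i) ≠ ⊤) (f : α → ℝ≥0∞)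
    (hf : Measurable f) {t : ℝ≥0∞} (ht : t ≠ ⊤) :
    t * μ {x | t < maxFn c μ f x} ≤ 2 * ∫⁻ x, {x | t ≤ 2 * f x}.indicator f x ∂μ := by
  set φ := {x | t ≤ 2 * f x}.indicator f
  have hφ : Measurable φ := hf.indicator (measurableSet_le measurable_const (hf.const_mul 2))
  have key : ∀ i, t < avg μ f (c i) → t * μ (c i) ≤ 2 * ∫⁻ x in c i, φ x ∂μ := by
    intro i hi
    have h1 : t * μ (c i) ≤ ∫⁻ x in c i, f x ∂μ := by
      rw [← avg_mul_measure f (hμ i)]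
      gcongr
    have h2 : 2 * ∫⁻ x in c i, f x ∂μ ≤ 2 * (∫⁻ x in c i, φ x ∂μ) + t * μ (c i) := by
      rw [← setLIntegral_const, ← lintegral_const_mul _ hf, ← lintegral_const_mul _ hφ,
        ← lintegral_add_right _ measurable_const]
      refine lintegral_mono fun x => ?_
      by_cases hx : t ≤ 2 * f x
      · simp [φ, Set.indicator_of_mem (show x ∈ {x | t ≤ 2 * f x} from hx)]
      · simpa [φ, hx] using (not_le.1 hx).le
    have h3 : t * μ (c i) + t * μ (c i) ≤ 2 * (∫⁻ x in c i, φ x ∂μ) + t * μ (c i) := by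
      rw [← two_mul]
      exact (mul_le_mul_right h1 2).trans h2
    exact (ENNReal.add_le_add_iff_right (ENNReal.mul_ne_top ht (hμ i))).1 h3
  have hfin : ∀ B : Finset ι, (∀ i ∈ B, t < avg μ f (c i)) →
      t * μ (⋃ i ∈ B, c i) ≤ 2 * ∫⁻ x, φ x ∂μ := by
    intro B hB
    obtain ⟨B', hB', hd, hcov⟩ := hc.exists_disjoint_cover B
    have hsub : (⋃ i ∈ B, c i) ⊆ ⋃ i ∈ B', c i := by
      intro x hx
      simp only [Set.mem_iUnion] at hx ⊢
      obtain ⟨i, hi, hx⟩ := hx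
      obtain ⟨j, hj, hij⟩ := hcov i hi
      exact ⟨j, hj, hij hx⟩
    calc t * μ (⋃ i ∈ B, c i) ≤ t * ∑ i ∈ B', μ (c i) := by
          gcongr
          exact (measure_mono hsub).trans (measure_biUnion_finset_le _ _)
      _ = ∑ i ∈ B', t * μ (c i) := Finset.mul_sum _ _ _
      _ ≤ ∑ i ∈ B', 2 * ∫⁻ x in c i, φ x ∂μ :=
          Finset.sum_le_sum fun i hi => key i (hB i (hB' hi))
      _ = 2 * ∫⁻ x in ⋃ i ∈ B', c i, φ x ∂μ := by
          rw [lintegral_biUnion_finset hd (fun i _ => hm i), Finset.mul_sum]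
      _ ≤ _ := mul_le_mul_right (setLIntegral_le_lintegral _ _) _
  have hset : {x | t < maxFn c μ f x}
      = ⋃ B : Finset ι, ⋃ i ∈ B.filter (fun i => t < avg μ f (c i)), c i := by
    ext x
    simp only [Set.mem_ofPred_eq, maxFn, lt_iSup_iff, Set.mem_iUnion, Finset.mem_filter]
    constructor
    · rintro ⟨i, hi⟩
      have hx : x ∈ c i := by
        by_contra h
        simp [h] at hi
      rw [Set.indicator_of_mem hx] at hi
      exact ⟨{i}, i, ⟨by simp, hi⟩, hx⟩
    · rintro ⟨B, i, ⟨_, hi⟩, hx⟩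
      exact ⟨i, by rwa [Set.indicator_of_mem hx]⟩
  rw [hset, Directed.measure_iUnion, ENNReal.mul_iSup]
  · exact iSup_le fun B => hfin _ fun i hi => (Finset.mem_filter.1 hi).2
  · refine Monotone.directed_le fun B B' h => ?_
    exact Set.biUnion_subset_biUnion_left fun i hi =>
      Finset.mem_filter.2 ⟨h (Finset.mem_filter.1 hi).1, (Finset.mem_filter.1 hi).2⟩

/-- The constant in the strong type maximal inequality. -/
def maxConst (p : ℝ) : ℝ≥0∞ := 2 ^ p * (2 * (geomConst (p - 1) * 2 ^ (p - 1)))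

lemma maxConst_ne_top {p : ℝ} (hp : 1 < p) : maxConst p ≠ ⊤ := by
  have h1 : ∀ s : ℝ, 0 < s → (2 : ℝ≥0∞) ^ s ≠ ⊤ := fun s hs =>
    ENNReal.rpow_ne_top_of_nonneg hs.le (by norm_num)
  exact ENNReal.mul_ne_top (h1 _ (by linarith)) (ENNReal.mul_ne_top (by norm_num)
    (ENNReal.mul_ne_top (geomConst_ne_top (by linarith)) (h1 _ (by linarith))))

lemma IsLaminar.lintegral_maxFn_rpow_le [Countable ι] {c : ι → Set α} (hc : IsLaminar c)
    (hm : ∀ i, MeasurableSet (c i)) {μ : Measure α} (hμ : ∀ i, μ (c i) ≠ ⊤) {f : α → ℝ≥0∞}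
    (hf : Measurable f) {p : ℝ} (hp : 1 < p) :
    ∫⁻ x, maxFn c μ f x ^ p ∂μ ≤ maxConst p * ∫⁻ x, f x ^ p ∂μ := by
  have hM := measurable_maxFn hm μ f
  have hmeas : ∀ k : ℤ, MeasurableSet {x | (2 : ℝ≥0∞) ^ k < maxFn c μ f x} := fun k =>
    measurableSet_lt measurable_const hM
  have hmeas' : ∀ k : ℤ, MeasurableSet {x | (2 : ℝ≥0∞) ^ k ≤ 2 * f x} := fun k =>
    measurableSet_le measurable_const (hf.const_mul 2)
  calc ∫⁻ x, maxFn c μ f x ^ p ∂μ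
      ≤ ∫⁻ x, 2 ^ p * ∑' k : ℤ,
          {x | (2 : ℝ≥0∞) ^ k < maxFn c μ f x}.indicator (fun _ => ((2 : ℝ≥0∞) ^ k) ^ p) x ∂μ := by
        refine lintegral_mono fun x => (rpow_le_tsum_dyadic (by linarith) _).trans_eq ?_
        simp only [Set.indicator_apply, Set.mem_ofPred_eq]
    _ = 2 ^ p * ∑' k : ℤ, ((2 : ℝ≥0∞) ^ k) ^ p * μ {x | (2 : ℝ≥0∞) ^ k < maxFn c μ f x} := by
        rw [lintegral_const_mul, lintegral_tsum]
        · congr 2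
          ext k
          rw [lintegral_indicator_const (hmeas k)]
        · exact fun k => (measurable_const.indicator (hmeas k)).aemeasurable
        · exact Measurable.tsum fun k => measurable_const.indicator (hmeas k)
    _ ≤ 2 ^ p * ∑' k : ℤ, ((2 : ℝ≥0∞) ^ k) ^ (p - 1) *
          (2 * ∫⁻ x, {x | (2 : ℝ≥0∞) ^ k ≤ 2 * f x}.indicator f x ∂μ) := by
        refine mul_le_mul_right (ENNReal.tsum_le_tsum fun k => ?_) _
        rw [rpow_eq_rpow_sub_one_mul hp.le, mul_assoc]
        refine mul_le_mul_right ?_ _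
        exact hc.mul_measure_maxFn_gt_le hm hμ f hf (dyadic_zpow_ne_top k)
    _ = 2 ^ p * (2 * ∫⁻ x, ∑' k : ℤ, ((2 : ℝ≥0∞) ^ k) ^ (p - 1) *
          {x | (2 : ℝ≥0∞) ^ k ≤ 2 * f x}.indicator f x ∂μ) := by
        rw [lintegral_tsum fun k => ((hf.indicator (hmeas' k)).const_mul _).aemeasurable,
          ← ENNReal.tsum_mul_left,
          ← ENNReal.tsum_mul_left, ← ENNReal.tsum_mul_left]
        congr 1
        funext k
        rw [lintegral_const_mul _ (hf.indicator (hmeas' k))]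
        ring
    _ ≤ 2 ^ p * (2 * ∫⁻ x, (geomConst (p - 1) * 2 ^ (p - 1)) * f x ^ p ∂μ) := by
        gcongr with x
        calc _ = (∑' k : ℤ, if (2 : ℝ≥0∞) ^ k ≤ 2 * f x
                then ((2 : ℝ≥0∞) ^ k) ^ (p - 1) else 0) * f x := by
              rw [← ENNReal.tsum_mul_right]
              congr 1
              ext k
              simp only [Set.indicator_apply, Set.mem_ofPred_eq]
              split_ifs <;> simp
          _ ≤ (geomConst (p - 1) * (2 * f x) ^ (p - 1)) * f x := by
              gcongr
              exact tsum_dyadic_rpow_le (by linarith) _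
          _ = _ := by
              rw [ENNReal.mul_rpow_of_nonneg _ _ (by linarith : (0 : ℝ) ≤ p - 1), mul_assoc,
                mul_assoc, mul_assoc]
              rw [← rpow_eq_rpow_sub_one_mul hp.le]
    _ = _ := by
        rw [lintegral_const_mul _ (hf.pow_const _), maxConst]
        ring

/-! ### Positive operators and Wolff potentials over a laminar family -/

/-- The positive operator `∑ K(Q) (∫_Q f dσ) 1_Q` over a family of sets. -/
def laminarOp (c : ι → Set α) (K : ι → ℝ≥0∞) (σ : Measure α) (f : α → ℝ≥0∞) (x : α) : ℝ≥0∞ :=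
  ∑' i, (c i).indicator (fun _ => K i * ∫⁻ y in c i, f y ∂σ) x

/-- The sum `∑_{Q' ⊆ Q} K(Q') μ(Q') ν(Q')`. -/
def localMass (c : ι → Set α) (K : ι → ℝ≥0∞) (μ ν : Measure α) (i : ι) : ℝ≥0∞ :=
  ∑' j, if c j ⊆ c i then K j * μ (c j) * ν (c j) else 0

/-- The Wolff potential over a family of sets. -/
def laminarWolff (c : ι → Set α) (K : ι → ℝ≥0∞) (μ ν : Measure α) (s : ℝ) (x : α) : ℝ≥0∞ :=
  ∑' i, (c i).indicator
    (fun _ => K i * μ (c i) * (localMass c K μ ν i / μ (c i)) ^ (s - 1)) x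

lemma measurable_laminarOp [Countable ι] {c : ι → Set α} (hm : ∀ i, MeasurableSet (c i))
    (K : ι → ℝ≥0∞) (σ : Measure α) (f : α → ℝ≥0∞) : Measurable (laminarOp c K σ f) :=
  Measurable.tsum fun i => measurable_const.indicator (hm i)

lemma measurable_laminarWolff [Countable ι] {c : ι → Set α} (hm : ∀ i, MeasurableSet (c i))
    (K : ι → ℝ≥0∞) (μ ν : Measure α) (s : ℝ) : Measurable (laminarWolff c K μ ν s) :=
  Measurable.tsum fun i => measurable_const.indicator (hm i)

lemma lintegral_tsum_indicator_mul [Countable ι] {c : ι → Set α} (hm : ∀ i, MeasurableSet (c i))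
    (μ : Measure α) (b : ι → ℝ≥0∞) {g : α → ℝ≥0∞} (hg : Measurable g) :
    ∫⁻ x, (∑' i, (c i).indicator (fun _ => b i) x) * g x ∂μ
      = ∑' i, b i * ∫⁻ x in c i, g x ∂μ := by
  simp only [← ENNReal.tsum_mul_right]
  rw [lintegral_tsum (f := fun i x => (c i).indicator (fun _ => b i) x * g x)
    fun i => ((measurable_const.indicator (hm i)).mul hg).aemeasurable]
  congr 1
  funext i
  rw [← lintegral_const_mul _ hg, ← lintegral_indicator (hm i)]
  congr 1
  funext x
  by_cases hx : x ∈ c i <;> simp [hx]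

lemma lintegral_laminarOp_mul [Countable ι] {c : ι → Set α} (hm : ∀ i, MeasurableSet (c i))
    (K : ι → ℝ≥0∞) (σ ω : Measure α) (f : α → ℝ≥0∞) {g : α → ℝ≥0∞} (hg : Measurable g) :
    ∫⁻ x, laminarOp c K σ f x * g x ∂ω
      = ∑' i, K i * (∫⁻ x in c i, f x ∂σ) * ∫⁻ x in c i, g x ∂ω :=
  lintegral_tsum_indicator_mul hm ω _ hg

/-- Duality for the positive operator. -/
lemma laminarOp_dual_bound [Countable ι] {c : ι → Set α} (hm : ∀ i, MeasurableSet (c i))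
    (K : ι → ℝ≥0∞) (σ ω : Measure α) [SigmaFinite σ] {p p' q q' : ℝ} (hpp : p.HolderConjugate p')
    (hqq : q.HolderConjugate q') {C : ℝ≥0∞}
    (H : ∀ f : α → ℝ≥0∞, Measurable f → (∫⁻ x, laminarOp c K σ f x ^ q ∂ω) ^ (1 / q) ≤
      C * (∫⁻ x, f x ^ p ∂σ) ^ (1 / p)) (g : α → ℝ≥0∞) (hg : Measurable g) :
    (∫⁻ x, laminarOp c K ω g x ^ p' ∂σ) ^ (1 / p') ≤ C * (∫⁻ x, g x ^ q' ∂ω) ^ (1 / q') := by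
  refine lintegral_rpow_le_of_forall_mul_le σ hpp.symm (measurable_laminarOp hm K ω g)
    fun f hf _ => ?_
  calc ∫⁻ x, laminarOp c K ω g x * f x ∂σ = ∫⁻ x, laminarOp c K σ f x * g x ∂ω := by
        rw [lintegral_laminarOp_mul hm K ω σ g hf, lintegral_laminarOp_mul hm K σ ω f hg]
        congr 1
        funext i
        ring
    _ ≤ (∫⁻ x, laminarOp c K σ f x ^ q ∂ω) ^ (1 / q) * (∫⁻ x, g x ^ q' ∂ω) ^ (1 / q') :=
        ENNReal.lintegral_mul_le_Lp_mul_Lq ω hqq (measurable_laminarOp hm K σ f).aemeasurable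
          hg.aemeasurable
    _ ≤ _ := by
        rw [mul_right_comm]
        gcongr
        exact H f hf

/-! ### Necessity of the Wolff potential conditions -/

/-- The constant in the necessity of the Wolff potential condition. -/
def necConst (p q : ℝ) : ℝ≥0∞ := (maxConst q ^ (1 - 1 / q) * maxConst (p / q) ^ (q / p)) ^ (1 / q)

lemma necConst_ne_top {p q : ℝ} (hq : 1 < q) (hqp : q < p) : necConst p q ≠ ⊤ := by
  have hq0 : 0 < q := by linarith
  have hp0 : 0 < p := by linarith
  refine ENNReal.rpow_ne_top_of_nonneg (by positivity) (ENNReal.mul_ne_top ?_ ?_)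
  · refine ENNReal.rpow_ne_top_of_nonneg ?_ (maxConst_ne_top hq)
    rw [sub_nonneg, div_le_one hq0]
    exact hq.le
  · exact ENNReal.rpow_ne_top_of_nonneg (by positivity) (maxConst_ne_top ((one_lt_div hq0).2 hqp))

lemma wolff_term_le [Countable ι] {c : ι → Set α} (hm : ∀ i, MeasurableSet (c i))
    {σ ω : Measure α} (hσ : ∀ i, σ (c i) ≠ ⊤) (K : ι → ℝ≥0∞)
    {q : ℝ} (hq : 1 < q) (h : α → ℝ≥0∞) (i : ι) :
    K i * ω (c i) * (localMass c K ω σ i / ω (c i)) ^ (q - 1) * ∫⁻ x in c i, h x ∂σ ≤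
      K i * (∫⁻ x in c i, maxFn c σ h x ^ (1 / q) ∂σ) * ∫⁻ x in c i,
        maxFn c ω (laminarOp c K σ fun y => maxFn c σ h y ^ (1 / q)) x ^ (q - 1) ∂ω := by
  have hq0 : 0 < q := by linarith
  set φ := laminarOp c K σ fun y => maxFn c σ h y ^ (1 / q) with hφ
  set η := avg σ h (c i) with hη
  have hlow : ∀ j, c j ⊆ c i → η ^ (1 / q) * σ (c j) ≤ ∫⁻ x in c j, maxFn c σ h x ^ (1 / q) ∂σ := by
    intro j hj
    rw [← setLIntegral_const]
    refine setLIntegral_mono' (hm j) fun x hx => ?_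
    exact ENNReal.rpow_le_rpow (avg_le_maxFn (hj hx)) (by positivity)
  have hB : η ^ (1 / q) * localMass c K ω σ i ≤ ∫⁻ x in c i, φ x ∂ω := by
    rw [localMass, ← ENNReal.tsum_mul_left, hφ]
    simp only [laminarOp]
    rw [lintegral_tsum fun j => (measurable_const.indicator (hm j)).aemeasurable]
    refine ENNReal.tsum_le_tsum fun j => ?_
    split_ifs with hj
    · rw [setLIntegral_indicator (hm j), Set.inter_eq_left.2 hj, setLIntegral_const]
      calc _ = K j * (η ^ (1 / q) * σ (c j)) * ω (c j) := by ring
        _ ≤ _ := by gcongr; exact hlow j hj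
    · simp
  have hηp : η = η ^ (1 / q) * (η ^ (1 / q)) ^ (q - 1) := by
    rw [mul_comm, ← rpow_eq_rpow_sub_one_mul hq.le, ← ENNReal.rpow_mul, one_div_mul_cancel hq0.ne',
      ENNReal.rpow_one]
  have hbd : (η ^ (1 / q) * (localMass c K ω σ i / ω (c i))) ^ (q - 1) * ω (c i) ≤
      ∫⁻ x in c i, maxFn c ω φ x ^ (q - 1) ∂ω := by
    rw [← setLIntegral_const]
    refine setLIntegral_mono' (hm i) fun x hx => ?_
    refine ENNReal.rpow_le_rpow (le_trans ?_ (avg_le_maxFn hx)) (by linarith)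
    rw [← mul_div_assoc, avg]
    gcongr
  calc _ = K i * (η ^ (1 / q) * σ (c i)) *
        ((η ^ (1 / q) * (localMass c K ω σ i / ω (c i))) ^ (q - 1) * ω (c i)) := by
        rw [← avg_mul_measure h (hσ i), ← hη, ENNReal.mul_rpow_of_nonneg _ _ (by linarith)]
        nth_rewrite 1 [hηp]
        ring
    _ ≤ _ := by
        gcongr
        exact hlow i subset_rfl

lemma IsLaminar.wolff_norm_le [Countable ι] {c : ι → Set α} (hc : IsLaminar c)
    (hm : ∀ i, MeasurableSet (c i)) {σ ω : Measure α} [SigmaFinite σ] (hσ : ∀ i, σ (c i) ≠ ⊤)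
    (hω : ∀ i, ω (c i) ≠ ⊤) (K : ι → ℝ≥0∞) {p q r : ℝ} (hq : 1 < q) (hqp : q < p)
    (hr : 1 / q = 1 / r + 1 / p) {C : ℝ≥0∞}
    (H : ∀ f : α → ℝ≥0∞, Measurable f → (∫⁻ x, laminarOp c K σ f x ^ q ∂ω) ^ (1 / q) ≤
      C * (∫⁻ x, f x ^ p ∂σ) ^ (1 / p)) :
    (∫⁻ x, laminarWolff c K ω σ q x ^ (r / q) ∂σ) ^ (1 / r) ≤ necConst p q * C := by
  have hq0 : 0 < q := by linarith
  have hp0 : 0 < p := by linarith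
  have hr0 : 0 < r := by
    have : 1 / p < 1 / q := one_div_lt_one_div_of_lt hq0 hqp
    exact one_div_pos.1 (by linarith)
  have hpq1 : 1 < p / q := (one_lt_div hq0).2 hqp
  have hconj : (r / q).HolderConjugate (p / q) := by
    refine Real.HolderConjugate.symm ?_
    rw [Real.holderConjugate_iff]
    refine ⟨hpq1, ?_⟩
    field_simp at hr ⊢
    linarith
  have hqq := Real.HolderConjugate.conjExponent hq
  have hdual : (∫⁻ x, laminarWolff c K ω σ q x ^ (r / q) ∂σ) ^ (1 / (r / q)) ≤
      maxConst q ^ (1 - 1 / q) * maxConst (p / q) ^ (q / p) * C ^ q := by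
    refine lintegral_rpow_le_of_forall_mul_le σ hconj (measurable_laminarWolff hm K ω σ q)
      fun h hh _ => ?_
    set φ := laminarOp c K σ fun y => maxFn c σ h y ^ (1 / q) with hφ
    have hφm : Measurable φ := measurable_laminarOp hm K σ _
    have hMφ : Measurable (maxFn c ω φ) := measurable_maxFn hm ω φ
    have h1 : ∫⁻ x, laminarWolff c K ω σ q x * h x ∂σ ≤
        ∫⁻ x, φ x * maxFn c ω φ x ^ (q - 1) ∂ω := by
      rw [hφ, lintegral_laminarOp_mul hm K σ ω _ (hMφ.pow_const _)]
      simp only [laminarWolff]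
      rw [lintegral_tsum_indicator_mul hm σ _ hh]
      exact ENNReal.tsum_le_tsum fun i => wolff_term_le hm hσ K hq h i
    have h2 : ∫⁻ x, φ x * maxFn c ω φ x ^ (q - 1) ∂ω ≤
        maxConst q ^ (1 - 1 / q) * ∫⁻ x, φ x ^ q ∂ω := by
      refine (ENNReal.lintegral_mul_le_Lp_mul_Lq ω hqq hφm.aemeasurable
        (hMφ.pow_const _).aemeasurable).trans ?_
      simp only [← ENNReal.rpow_mul, hqq.sub_one_mul_conj]
      have he : 1 / q.conjExponent = 1 - 1 / q := by
        have := hqq.inv_add_inv_eq_one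
        simp only [one_div]
        linarith
      have hpos : 0 ≤ 1 - 1 / q := by rw [← he]; exact one_div_nonneg.2 hqq.symm.nonneg
      rw [he]
      calc _ ≤ (∫⁻ x, φ x ^ q ∂ω) ^ (1 / q) * (maxConst q * ∫⁻ x, φ x ^ q ∂ω) ^ (1 - 1 / q) := by
            gcongr
            exact hc.lintegral_maxFn_rpow_le hm hω hφm hq
        _ = maxConst q ^ (1 - 1 / q) *
            ((∫⁻ x, φ x ^ q ∂ω) ^ (1 / q) * (∫⁻ x, φ x ^ q ∂ω) ^ (1 - 1 / q)) := by
            rw [ENNReal.mul_rpow_of_nonneg _ _ hpos]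
            ring
        _ = _ := by
            rw [← ENNReal.rpow_add_of_nonneg _ _ (by positivity) hpos, add_sub_cancel,
              ENNReal.rpow_one]
    have h3 : ∫⁻ x, φ x ^ q ∂ω ≤
        C ^ q * (maxConst (p / q) * ∫⁻ x, h x ^ (p / q) ∂σ) ^ (q / p) := by
      have h4 := H (fun y => maxFn c σ h y ^ (1 / q)) ((measurable_maxFn hm σ h).pow_const _)
      simp only [← ENNReal.rpow_mul, one_div_mul_eq_div] at h4
      calc ∫⁻ x, φ x ^ q ∂ω = ((∫⁻ x, φ x ^ q ∂ω) ^ (1 / q)) ^ q := by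
            rw [← ENNReal.rpow_mul, one_div_mul_cancel hq0.ne', ENNReal.rpow_one]
        _ ≤ (C * (∫⁻ x, maxFn c σ h x ^ (p / q) ∂σ) ^ (1 / p)) ^ q := by gcongr
        _ = C ^ q * (∫⁻ x, maxFn c σ h x ^ (p / q) ∂σ) ^ (q / p) := by
            rw [ENNReal.mul_rpow_of_nonneg _ _ hq0.le, ← ENNReal.rpow_mul, one_div_mul_eq_div]
        _ ≤ _ := by
            gcongr
            exact hc.lintegral_maxFn_rpow_le hm hσ hh hpq1
    calc _ ≤ _ := h1.trans (h2.trans (mul_le_mul_right h3 _))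
      _ = _ := by
        rw [ENNReal.mul_rpow_of_nonneg _ _ (by positivity), one_div_div]
        ring
  calc _ = ((∫⁻ x, laminarWolff c K ω σ q x ^ (r / q) ∂σ) ^ (1 / (r / q))) ^ (1 / q) := by
        rw [← ENNReal.rpow_mul]
        congr 1
        field_simp
    _ ≤ (maxConst q ^ (1 - 1 / q) * maxConst (p / q) ^ (q / p) * C ^ q) ^ (1 / q) := by gcongr
    _ = _ := by
        rw [ENNReal.mul_rpow_of_nonneg _ _ (by positivity), ← ENNReal.rpow_mul C,
          mul_one_div_cancel hq0.ne', ENNReal.rpow_one, necConst]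

/-! ### Stopping families -/

lemma IsLaminar.sum_rpow_mul_le {c : ι → Set α} (hc : IsLaminar c)
    (hm : ∀ i, MeasurableSet (c i)) {ω : Measure α} {B : Finset ι} {E : Set α}
    (hBE : ∀ i ∈ B, c i ⊆ E) (hE0 : ω E ≠ 0) (hE : ω E ≠ ⊤) (a b : ι → ℝ≥0∞)
    (hb : ∀ i ∈ B, ∑ j ∈ B with c j ⊆ c i, a j ≤ b i) {q : ℝ} (hq : 1 < q) :
    (∑ i ∈ B, a i) ^ q * ω E ^ (1 - q) ≤
      2 ^ q * ∑ i ∈ B, a i * (b i / ω (c i)) ^ (q - 1) := by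
  have hq1 : 0 < q - 1 := by linarith
  have h2q : (2 : ℝ≥0∞) ^ q ≠ 0 := (ENNReal.rpow_pos (by norm_num) (by norm_num)).ne'
  set A := ∑ i ∈ B, a i with hA
  rcases eq_or_ne A ⊤ with hAt | hAt
  · obtain ⟨i, hi, hai⟩ := ENNReal.sum_eq_top.1 hAt
    have hbi : b i = ⊤ := by
      refine top_le_iff.1 (le_trans ?_ (hb i hi))
      rw [← hai]
      exact Finset.single_le_sum (f := a) (fun _ _ => zero_le)
        (Finset.mem_filter.2 ⟨hi, subset_rfl⟩)
    have htop : ∑ i ∈ B, a i * (b i / ω (c i)) ^ (q - 1) = ⊤ := by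
      refine ENNReal.sum_eq_top.2 ⟨i, hi, ?_⟩
      rw [hbi, hai, ENNReal.top_div_of_ne_top (ne_top_of_le_ne_top hE (measure_mono (hBE i hi))),
        ENNReal.top_rpow_of_pos hq1, ENNReal.top_mul_top]
    rw [htop, ENNReal.mul_top h2q]
    exact le_top
  set T := A * 2⁻¹ * (ω E)⁻¹ with hT
  have hTE : T * ω E = A * 2⁻¹ := by
    rw [hT, mul_assoc, ENNReal.inv_mul_cancel hE0 hE, mul_one]
  have hsmall : ∑ i ∈ B with ¬ T ≤ b i / ω (c i), a i ≤ A * 2⁻¹ := by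
    obtain ⟨B', hB', hd, hcov⟩ := hc.exists_disjoint_cover (B.filter fun i => ¬ T ≤ b i / ω (c i))
    calc ∑ i ∈ B with ¬ T ≤ b i / ω (c i), a i
        ≤ ∑ i ∈ B with ¬ T ≤ b i / ω (c i), ∑ j ∈ B', if c i ⊆ c j then a i else 0 := by
          refine Finset.sum_le_sum fun i hi => ?_
          obtain ⟨j, hj, hij⟩ := hcov i hi
          refine le_trans ?_ (Finset.single_le_sum (fun _ _ => zero_le) hj)
          rw [if_pos hij]
      _ ≤ ∑ i ∈ B, ∑ j ∈ B', if c i ⊆ c j then a i else 0 :=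
          Finset.sum_le_sum_of_subset (Finset.filter_subset _ _)
      _ = ∑ j ∈ B', ∑ i ∈ B with c i ⊆ c j, a i := by
          rw [Finset.sum_comm]
          simp only [Finset.sum_filter]
      _ ≤ ∑ j ∈ B', T * ω (c j) := by
          refine Finset.sum_le_sum fun j hj => ?_
          obtain ⟨hjB, hjT⟩ := Finset.mem_filter.1 (hB' hj)
          refine (hb j hjB).trans ?_
          by_contra! hlt
          exact hjT (ENNReal.le_div_iff_mul_le (Or.inr (ne_of_gt (lt_of_le_of_lt zero_le hlt)))
            (Or.inl (ne_top_of_le_ne_top hE (measure_mono (hBE j hjB)))) |>.2 hlt.le)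
      _ = T * ω (⋃ j ∈ B', c j) := by
          rw [measure_biUnion_finset hd fun j _ => hm j, Finset.mul_sum]
      _ ≤ T * ω E := by
          gcongr
          exact Set.iUnion₂_subset fun j hj => hBE j (Finset.mem_filter.1 (hB' hj)).1
      _ = A * 2⁻¹ := hTE
  have hlarge : A * 2⁻¹ ≤ ∑ i ∈ B with T ≤ b i / ω (c i), a i := by
    have h1 : A * 2⁻¹ + A * 2⁻¹ ≤ (∑ i ∈ B with T ≤ b i / ω (c i), a i) + A * 2⁻¹ := by
      rw [← mul_add, ENNReal.inv_two_add_inv_two, mul_one]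
      calc A = _ := (Finset.sum_filter_add_sum_filter_not B (fun i => T ≤ b i / ω (c i)) a).symm
        _ ≤ _ := by gcongr
    exact (ENNReal.add_le_add_iff_right (ENNReal.mul_ne_top hAt (by norm_num))).1 h1
  calc A ^ q * ω E ^ (1 - q) = 2 ^ q * (A * 2⁻¹ * T ^ (q - 1)) := by
        rw [hT, ENNReal.mul_rpow_of_nonneg _ _ hq1.le, ENNReal.inv_rpow, ← ENNReal.rpow_neg,
          neg_sub, rpow_eq_rpow_sub_one_mul hq.le A, ENNReal.mul_rpow_of_nonneg _ _ hq1.le]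
        have h2 : (2 : ℝ≥0∞) ^ q * ((2⁻¹ : ℝ≥0∞) ^ (q - 1) * 2⁻¹) = 1 := by
          rw [← rpow_eq_rpow_sub_one_mul hq.le, ENNReal.inv_rpow,
            ENNReal.mul_inv_cancel h2q (ENNReal.rpow_ne_top_of_nonneg (by linarith) (by norm_num))]
        calc _ = (2 : ℝ≥0∞) ^ q * ((2⁻¹ : ℝ≥0∞) ^ (q - 1) * 2⁻¹) *
              (A ^ (q - 1) * A * ω E ^ (1 - q)) := by rw [h2, one_mul]
          _ = _ := by ring
    _ ≤ 2 ^ q * ((∑ i ∈ B with T ≤ b i / ω (c i), a i) * T ^ (q - 1)) := by gcongr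
    _ ≤ 2 ^ q * ∑ i ∈ B with T ≤ b i / ω (c i), a i * (b i / ω (c i)) ^ (q - 1) := by
        rw [Finset.sum_mul]
        gcongr with i hi
        exact (Finset.mem_filter.1 hi).2
    _ ≤ _ := by
        gcongr
        exact Finset.filter_subset _ _

/-- Given a finite subfamily on which the averages of `f` are positive and finite, one can attach
to each member a dyadic level which dominates the average, increases as the sets shrink, and is
controlled by the maximal function. -/
lemma exists_level {c : ι → Set α} {μ : Measure α} {f : α → ℝ≥0∞} (S : Finset ι)
    (h0 : ∀ i ∈ S, avg μ f (c i) ≠ 0) (ht : ∀ i ∈ S, avg μ f (c i) ≠ ⊤) :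
    ∃ m : ι → ℤ, (∀ i ∈ S, avg μ f (c i) ≤ 2 * 2 ^ m i) ∧
      (∀ i ∈ S, ∀ j ∈ S, c i ⊆ c j → m j ≤ m i) ∧
      ∀ i ∈ S, ∀ x ∈ c i, (2 : ℝ≥0∞) ^ m i ≤ maxFn c μ f x := by
  set F : ι → ℝ≥0∞ := fun i => (S.filter fun j => c i ⊆ c j).sup fun j => avg μ f (c j) with hF
  have hle : ∀ i ∈ S, avg μ f (c i) ≤ F i := fun i hi =>
    Finset.le_sup (f := fun j => avg μ f (c j)) (Finset.mem_filter.2 ⟨hi, subset_rfl⟩)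
  have hex : ∀ i ∈ S, ∃ k : ℤ, (2 : ℝ≥0∞) ^ k ≤ F i ∧ F i < 2 * 2 ^ k := by
    intro i hi
    have hFt : F i ≠ ⊤ := by
      rw [← lt_top_iff_ne_top, hF, Finset.sup_lt_iff (by simp)]
      exact fun j hj => (ht j (Finset.mem_filter.1 hj).1).lt_top
    have hF0 : F i ≠ 0 := fun h => h0 i hi (le_zero_iff.1 (h ▸ hle i hi))
    obtain ⟨k, h1, h2⟩ := ENNReal.exists_mem_Ico_zpow hF0 hFt (y := 2) (by norm_num) (by norm_num)
    rw [ENNReal.zpow_add (by norm_num) (by norm_num), zpow_one, mul_comm] at h2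
    exact ⟨k, h1, h2⟩
  choose! m hm1 hm2 using hex
  refine ⟨m, fun i hi => (hle i hi).trans (hm2 i hi).le, fun i hi j hj hij => ?_, fun i hi x hx => ?_⟩
  · have hFF : F j ≤ F i := Finset.sup_mono fun k hk => by
      obtain ⟨hk1, hk2⟩ := Finset.mem_filter.1 hk
      exact Finset.mem_filter.2 ⟨hk1, hij.trans hk2⟩
    have h := ((hm1 j hj).trans hFF).trans_lt (hm2 i hi)
    by_contra! hlt
    refine absurd h (not_lt.2 ?_)
    have : (2 : ℝ≥0∞) * 2 ^ m i = 2 ^ (m i + 1) := by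
      rw [ENNReal.zpow_add (by norm_num) (by norm_num), zpow_one, mul_comm]
    rw [this]
    exact dyadic_zpow_le_iff.2 (by omega)
  · refine (hm1 i hi).trans (Finset.sup_le fun j hj => ?_)
    exact avg_le_maxFn ((Finset.mem_filter.1 hj).2 hx)

/-- The stopping set of a member: a maximal member of the same level containing it. -/
lemma IsLaminar.exists_stopping {α ι : Type*} {c : ι → Set α} (hc : IsLaminar c) (S : Finset ι)
    (l : ι → ℤ) (hl : ∀ i ∈ S, ∀ j ∈ S, c i ⊆ c j → l j ≤ l i) :
    ∃ G : ι → ι, (∀ i ∈ S, G i ∈ S) ∧ (∀ i ∈ S, c i ⊆ c (G i)) ∧ (∀ i ∈ S, l (G i) = l i) ∧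
      ∀ i ∈ S, ∀ j ∈ S, l i = l j → G i ≠ G j → Disjoint (c (G i)) (c (G j)) := by
  choose B hBS hd hcov using fun k : ℤ => hc.exists_disjoint_cover (S.filter fun i => k ≤ l i)
  have hex : ∀ i ∈ S, ∃ j ∈ B (l i), c i ⊆ c j := fun i hi =>
    hcov (l i) i (Finset.mem_filter.2 ⟨hi, le_rfl⟩)
  choose! G hGB hG using hex
  have hGS : ∀ i ∈ S, G i ∈ S ∧ l i ≤ l (G i) := fun i hi =>
    Finset.mem_filter.1 (hBS _ (hGB i hi))
  refine ⟨G, fun i hi => (hGS i hi).1, hG, fun i hi => ?_, fun i hi j hj hij hne => ?_⟩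
  · exact le_antisymm (hl i hi _ (hGS i hi).1 (hG i hi)) (hGS i hi).2
  · exact hd (l i) (hGB i hi) (hij ▸ hGB j hj) hne

lemma sum_stopping_le {c : ι → Set α} (hm : ∀ i, MeasurableSet (c i)) (ω : Measure α)
    {s : ℝ} (hs : 0 < s) (I : Finset ι) (l : ι → ℤ)
    (hd : ∀ g ∈ I, ∀ h ∈ I, l g = l h → g ≠ h → Disjoint (c g) (c h)) {Φ : α → ℝ≥0∞}
    (hΦ : Measurable Φ) (hv : ∀ g ∈ I, ∀ x ∈ c g, (2 : ℝ≥0∞) ^ l g ≤ Φ x) :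
    ∑ g ∈ I, ((2 : ℝ≥0∞) ^ l g) ^ s * ω (c g) ≤ geomConst s * ∫⁻ x, Φ x ^ s ∂ω := by
  calc ∑ g ∈ I, ((2 : ℝ≥0∞) ^ l g) ^ s * ω (c g)
      = ∫⁻ x, ∑ g ∈ I, (c g).indicator (fun _ => ((2 : ℝ≥0∞) ^ l g) ^ s) x ∂ω := by
        rw [lintegral_finsetSum _ fun g _ => measurable_const.indicator (hm g)]
        simp only [lintegral_indicator_const (hm _)]
    _ ≤ ∫⁻ x, geomConst s * Φ x ^ s ∂ω := by
        refine lintegral_mono fun x => le_trans ?_ (tsum_dyadic_rpow_le hs (Φ x))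
        have hinj : Set.InjOn l (I.filter fun g => x ∈ c g : Finset ι) := by
          intro g hg h hh hgh
          obtain ⟨hg1, hg2⟩ := Finset.mem_filter.1 (Finset.mem_coe.1 hg)
          obtain ⟨hh1, hh2⟩ := Finset.mem_filter.1 (Finset.mem_coe.1 hh)
          by_contra hne
          exact Set.disjoint_left.1 (hd g hg1 h hh1 hgh hne) hg2 hh2
        calc ∑ g ∈ I, (c g).indicator (fun _ => ((2 : ℝ≥0∞) ^ l g) ^ s) x
            = ∑ g ∈ I with x ∈ c g, ((2 : ℝ≥0∞) ^ l g) ^ s := by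
              rw [Finset.sum_filter]
              simp only [Set.indicator_apply]
          _ = ∑ g ∈ I with x ∈ c g,
                (if (2 : ℝ≥0∞) ^ l g ≤ Φ x then ((2 : ℝ≥0∞) ^ l g) ^ s else 0) := by
              refine Finset.sum_congr rfl fun g hg => ?_
              obtain ⟨hg1, hg2⟩ := Finset.mem_filter.1 hg
              rw [if_pos (hv g hg1 x hg2)]
          _ = ∑ k ∈ (I.filter fun g => x ∈ c g).image l,
                (if (2 : ℝ≥0∞) ^ k ≤ Φ x then ((2 : ℝ≥0∞) ^ k) ^ s else 0) := by
              rw [Finset.sum_image hinj]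
          _ ≤ _ := ENNReal.sum_le_tsum _
    _ = _ := lintegral_const_mul _ (hΦ.pow_const _)

/-! ### Sufficiency of the Wolff potential conditions -/

lemma IsLaminar.sum_le_of_stopping [Countable ι] {c : ι → Set α} (hc : IsLaminar c)
    (hm : ∀ i, MeasurableSet (c i)) {σ ω : Measure α} (hω : ∀ i, ω (c i) ≠ ⊤) (K : ι → ℝ≥0∞)
    {q q' : ℝ} (hqq : q.HolderConjugate q') (S : Finset ι) (h0 : ∀ i ∈ S, ω (c i) ≠ 0)
    (m l : ι → ℤ) (G : ι → ι) (hG : ∀ i ∈ S, c i ⊆ c (G i)) (hGm : ∀ i ∈ S, m (G i) = m i)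
    (hGl : ∀ i ∈ S, l (G i) = l i)
    (hGd : ∀ i ∈ S, ∀ j ∈ S, l i = l j → G i ≠ G j → Disjoint (c (G i)) (c (G j)))
    {Φ Ψ : α → ℝ≥0∞} (hΦ : Measurable Φ) (hΨ : Measurable Ψ)
    (hv : ∀ i ∈ S, ∀ x ∈ c (G i), (2 : ℝ≥0∞) ^ l i ≤ Φ x)
    (hu : ∀ i ∈ S, ∀ x ∈ c i, (2 : ℝ≥0∞) ^ m i ≤ Ψ x) :
    ∑ i ∈ S, K i * ω (c i) * σ (c i) * (2 ^ m i * 2 ^ l i) ≤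
      (geomConst q' * ∫⁻ x, Φ x ^ q' ∂ω) ^ (1 / q') *
        (2 ^ q * ∫⁻ x, laminarWolff c K ω σ q x * Ψ x ^ q ∂σ) ^ (1 / q) := by
  have hq := hqq.lt
  have hq' := hqq.symm.pos
  set a : ι → ℝ≥0∞ := fun i => K i * ω (c i) * σ (c i) with ha
  set b : ι → ℝ≥0∞ := localMass c K ω σ with hb
  set I := S.image G with hI
  set A : ι → ℝ≥0∞ := fun g => ∑ i ∈ S with G i = g, a i with hA
  have hmaps : ∀ i ∈ S, G i ∈ I := fun i hi => Finset.mem_image_of_mem G hi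
  have hg0 : ∀ g ∈ I, ω (c g) ≠ 0 := by
    intro g hg
    obtain ⟨i, hi, rfl⟩ := Finset.mem_image.1 hg
    exact fun h => h0 i hi (measure_mono_null (hG i hi) h)
  have hsum : ∑ i ∈ S, a i * (2 ^ m i * 2 ^ l i) = ∑ g ∈ I,
      ((2 : ℝ≥0∞) ^ l g * ω (c g) ^ (1 / q')) * (2 ^ m g * A g * ω (c g) ^ (-(1 / q'))) := by
    rw [← Finset.sum_fiberwise_of_maps_to hmaps]
    refine Finset.sum_congr rfl fun g hg => ?_
    have h1 : ω (c g) ^ (1 / q') * ω (c g) ^ (-(1 / q')) = 1 := by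
      rw [← ENNReal.rpow_add _ _ (hg0 g hg) (hω g), add_neg_cancel, ENNReal.rpow_zero]
    calc ∑ i ∈ S with G i = g, a i * (2 ^ m i * 2 ^ l i)
        = ∑ i ∈ S with G i = g, a i * (2 ^ m g * 2 ^ l g) := by
          refine Finset.sum_congr rfl fun i hi => ?_
          obtain ⟨hiS, hig⟩ := Finset.mem_filter.1 hi
          rw [← hig, hGm i hiS, hGl i hiS]
      _ = A g * (2 ^ m g * 2 ^ l g) := by rw [← Finset.sum_mul]
      _ = A g * (2 ^ m g * 2 ^ l g) * (ω (c g) ^ (1 / q') * ω (c g) ^ (-(1 / q'))) := by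
          rw [h1, mul_one]
      _ = _ := by ring
  have hfirst : ∑ g ∈ I, ((2 : ℝ≥0∞) ^ l g * ω (c g) ^ (1 / q')) ^ q' ≤
      geomConst q' * ∫⁻ x, Φ x ^ q' ∂ω := by
    refine le_trans (le_of_eq (Finset.sum_congr rfl fun g _ => ?_))
      (sum_stopping_le hm ω hq' I l ?_ hΦ ?_)
    · rw [ENNReal.mul_rpow_of_nonneg _ _ hq'.le, ← ENNReal.rpow_mul (ω (c g)),
        one_div_mul_cancel hq'.ne', ENNReal.rpow_one]
    · intro g hg h hh hgh hne
      obtain ⟨i, hi, rfl⟩ := Finset.mem_image.1 hg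
      obtain ⟨j, hj, rfl⟩ := Finset.mem_image.1 hh
      exact hGd i hi j hj (by rw [← hGl i hi, ← hGl j hj, hgh]) hne
    · intro g hg x hx
      obtain ⟨i, hi, rfl⟩ := Finset.mem_image.1 hg
      rw [hGl i hi]
      exact hv i hi x hx
  have hsecond : ∑ g ∈ I, (2 ^ m g * A g * ω (c g) ^ (-(1 / q'))) ^ q ≤
      2 ^ q * ∫⁻ x, laminarWolff c K ω σ q x * Ψ x ^ q ∂σ := by
    calc ∑ g ∈ I, (2 ^ m g * A g * ω (c g) ^ (-(1 / q'))) ^ q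
        = ∑ g ∈ I, (2 ^ m g) ^ q * (A g ^ q * ω (c g) ^ (1 - q)) := by
          refine Finset.sum_congr rfl fun g _ => ?_
          rw [ENNReal.mul_rpow_of_nonneg _ _ hqq.nonneg, ENNReal.mul_rpow_of_nonneg _ _ hqq.nonneg,
            ← ENNReal.rpow_mul (ω (c g)), mul_assoc]
          have : -(1 / q') * q = 1 - q := by
            have := hqq.div_conj_eq_sub_one
            rw [neg_mul, one_div_mul_eq_div, this]
            ring
          rw [this]
      _ ≤ ∑ g ∈ I, (2 ^ m g) ^ q *
            (2 ^ q * ∑ i ∈ S with G i = g, a i * (b i / ω (c i)) ^ (q - 1)) := by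
          refine Finset.sum_le_sum fun g hg => mul_le_mul_right ?_ _
          refine hc.sum_rpow_mul_le hm ?_ (hg0 g hg) (hω g) a b ?_ hq
          · intro i hi
            obtain ⟨hiS, hig⟩ := Finset.mem_filter.1 hi
            exact hig ▸ hG i hiS
          · intro i _
            rw [hb, localMass, Finset.sum_filter]
            refine le_trans ?_ (ENNReal.sum_le_tsum (S.filter fun i => G i = g))
            exact Finset.sum_le_sum fun j _ => le_rfl
      _ = 2 ^ q * ∑ g ∈ I, ∑ i ∈ S with G i = g,
            (2 ^ m i) ^ q * (a i * (b i / ω (c i)) ^ (q - 1)) := by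
          rw [Finset.mul_sum]
          refine Finset.sum_congr rfl fun g _ => ?_
          rw [mul_left_comm, Finset.mul_sum]
          congr 1
          refine Finset.sum_congr rfl fun i hi => ?_
          obtain ⟨hiS, hig⟩ := Finset.mem_filter.1 hi
          rw [← hig, hGm i hiS]
      _ = 2 ^ q * ∑ i ∈ S, (2 ^ m i) ^ q * (a i * (b i / ω (c i)) ^ (q - 1)) := by
          rw [Finset.sum_fiberwise_of_maps_to hmaps]
      _ ≤ 2 ^ q * ∑ i ∈ S, K i * ω (c i) * (b i / ω (c i)) ^ (q - 1) *
            ∫⁻ x in c i, Ψ x ^ q ∂σ := by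
          refine mul_le_mul_right (Finset.sum_le_sum fun i hi => ?_) _
          have : ((2 : ℝ≥0∞) ^ m i) ^ q * σ (c i) ≤ ∫⁻ x in c i, Ψ x ^ q ∂σ := by
            rw [← setLIntegral_const]
            exact setLIntegral_mono' (hm i) fun x hx =>
              ENNReal.rpow_le_rpow (hu i hi x hx) hqq.nonneg
          calc _ = K i * ω (c i) * (b i / ω (c i)) ^ (q - 1) * ((2 ^ m i) ^ q * σ (c i)) := by
                simp only [ha]
                ring
            _ ≤ _ := mul_le_mul_right this _
      _ ≤ _ := by
          simp only [laminarWolff]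
          rw [lintegral_tsum_indicator_mul hm σ _ (hΨ.pow_const _)]
          gcongr
          exact ENNReal.sum_le_tsum S
  rw [hsum]
  refine (ENNReal.inner_le_Lp_mul_Lq I _ _ hqq.symm).trans ?_
  have := hqq.pos
  gcongr

lemma lintegral_mul_rpow_le {μ : Measure α} {W Ψ : α → ℝ≥0∞} (hW : Measurable W)
    (hΨ : Measurable Ψ) {p q r : ℝ} (hq : 1 < q) (hqp : q < p) (hr : 1 / q = 1 / r + 1 / p) :
    (∫⁻ x, W x * Ψ x ^ q ∂μ) ^ (1 / q) ≤
      (∫⁻ x, W x ^ (r / q) ∂μ) ^ (1 / r) * (∫⁻ x, Ψ x ^ p ∂μ) ^ (1 / p) := by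
  have hq0 : 0 < q := by linarith
  have hp0 : 0 < p := by linarith
  have hr0 : 0 < r := by
    have : 1 / p < 1 / q := one_div_lt_one_div_of_lt hq0 hqp
    exact one_div_pos.1 (by linarith)
  have hconj : (r / q).HolderConjugate (p / q) := by
    rw [Real.holderConjugate_iff]
    have h : (r / q)⁻¹ + (p / q)⁻¹ = 1 := by
      rw [inv_div, inv_div, div_eq_mul_one_div, div_eq_mul_one_div q p, ← mul_add, ← hr]
      field_simp
    refine ⟨?_, h⟩
    have : 0 < (p / q)⁻¹ := by positivity
    have h2 : (r / q)⁻¹ < 1 := by linarith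
    exact (inv_lt_one₀ (by positivity)).1 h2
  have key := ENNReal.lintegral_mul_le_Lp_mul_Lq μ hconj hW.aemeasurable
    (hΨ.pow_const q).aemeasurable
  refine (ENNReal.rpow_le_rpow key (by positivity)).trans (le_of_eq ?_)
  rw [ENNReal.mul_rpow_of_nonneg _ _ (by positivity), ← ENNReal.rpow_mul, ← ENNReal.rpow_mul]
  have h1 : 1 / (r / q) * (1 / q) = 1 / r := by field_simp
  have h2 : 1 / (p / q) * (1 / q) = 1 / p := by field_simp
  rw [h1, h2]
  congr 3
  funext x
  rw [← ENNReal.rpow_mul, mul_div_cancel₀ _ hq0.ne']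

lemma IsLaminar.sum_le_wolff_norm_of_stopping [Countable ι] {c : ι → Set α} (hc : IsLaminar c)
    (hm : ∀ i, MeasurableSet (c i)) {σ ω : Measure α} (hω : ∀ i, ω (c i) ≠ ⊤)
    (hσ : ∀ i, σ (c i) ≠ ⊤) (K : ι → ℝ≥0∞)
    {p q q' r : ℝ} (hqq : q.HolderConjugate q') (hqp : q < p) (hr : 1 / q = 1 / r + 1 / p)
    (S : Finset ι) (h0 : ∀ i ∈ S, ω (c i) ≠ 0)
    (m l : ι → ℤ) (G : ι → ι) (hG : ∀ i ∈ S, c i ⊆ c (G i)) (hGm : ∀ i ∈ S, m (G i) = m i)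
    (hGl : ∀ i ∈ S, l (G i) = l i)
    (hGd : ∀ i ∈ S, ∀ j ∈ S, l i = l j → G i ≠ G j → Disjoint (c (G i)) (c (G j)))
    {f g : α → ℝ≥0∞} (hf : Measurable f) (hg : Measurable g)
    (hv : ∀ i ∈ S, ∀ x ∈ c (G i), (2 : ℝ≥0∞) ^ l i ≤ maxFn c ω g x)
    (hu : ∀ i ∈ S, ∀ x ∈ c i, (2 : ℝ≥0∞) ^ m i ≤ maxFn c σ f x) :
    ∑ i ∈ S, K i * ω (c i) * σ (c i) * (2 ^ m i * 2 ^ l i) ≤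
      2 * geomConst q' ^ (1 / q') * (maxConst q' ^ (1 / q') * maxConst p ^ (1 / p)) *
        (∫⁻ x, laminarWolff c K ω σ q x ^ (r / q) ∂σ) ^ (1 / r) *
        ((∫⁻ x, f x ^ p ∂σ) ^ (1 / p) * (∫⁻ x, g x ^ q' ∂ω) ^ (1 / q')) := by
  have hq := hqq.lt
  have hq' := hqq.symm.lt
  have hq0 := hqq.pos
  have hq0' := hqq.symm.pos
  have hp0 : 0 < p := by linarith
  have h1 : (geomConst q' * ∫⁻ x, maxFn c ω g x ^ q' ∂ω) ^ (1 / q') ≤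
      geomConst q' ^ (1 / q') * (maxConst q' ^ (1 / q') * (∫⁻ x, g x ^ q' ∂ω) ^ (1 / q')) := by
    rw [← ENNReal.mul_rpow_of_nonneg _ _ (by positivity),
      ← ENNReal.mul_rpow_of_nonneg _ _ (by positivity)]
    gcongr
    exact hc.lintegral_maxFn_rpow_le hm hω hg hq'
  have h2 : (2 ^ q * ∫⁻ x, laminarWolff c K ω σ q x * maxFn c σ f x ^ q ∂σ) ^ (1 / q) ≤
      2 * ((∫⁻ x, laminarWolff c K ω σ q x ^ (r / q) ∂σ) ^ (1 / r) *
        (maxConst p ^ (1 / p) * (∫⁻ x, f x ^ p ∂σ) ^ (1 / p))) := by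
    rw [ENNReal.mul_rpow_of_nonneg _ _ (by positivity), ← ENNReal.rpow_mul,
      mul_one_div_cancel hq0.ne', ENNReal.rpow_one]
    refine mul_le_mul_right ((lintegral_mul_rpow_le (measurable_laminarWolff hm K ω σ q)
      (measurable_maxFn hm σ f) hq hqp hr).trans (mul_le_mul_right ?_ _)) _
    rw [← ENNReal.mul_rpow_of_nonneg _ _ (by positivity)]
    gcongr
    exact hc.lintegral_maxFn_rpow_le hm hσ hf (hq.trans hqp)
  refine (hc.sum_le_of_stopping hm hω K hqq S h0 m l G hG hGm hGl hGd (measurable_maxFn hm ω g)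
    (measurable_maxFn hm σ f) hv hu).trans ((mul_le_mul' h1 h2).trans (le_of_eq ?_))
  ring

lemma avg_ne_top {μ : Measure α} {f : α → ℝ≥0∞} {s : Set α} (h0 : μ s ≠ 0) (hs : μ s ≠ ⊤)
    {p : ℝ} (hp : 1 ≤ p) (hf : ∫⁻ x, f x ^ p ∂μ ≠ ⊤) : avg μ f s ≠ ⊤ := by
  refine ENNReal.div_ne_top (ne_top_of_le_ne_top (b := μ s + ∫⁻ x, f x ^ p ∂μ)
    (ENNReal.add_ne_top.2 ⟨hs, hf⟩) ?_) h0
  calc ∫⁻ x in s, f x ∂μ ≤ ∫⁻ x in s, (1 + f x ^ p) ∂μ := by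
        refine lintegral_mono fun x => ?_
        rcases le_total (f x) 1 with h | h
        · exact h.trans le_self_add
        · exact (ENNReal.le_rpow_self_of_one_le h hp).trans le_add_self
    _ = μ s + ∫⁻ x in s, f x ^ p ∂μ := by
        rw [lintegral_add_left measurable_const, setLIntegral_one]
    _ ≤ _ := by
        gcongr
        exact Measure.restrict_le_self

/-- The constant in the sufficiency of the Wolff potential conditions. -/
def suffConst (p q' : ℝ) : ℝ≥0∞ :=
  4 * (2 * geomConst q' ^ (1 / q') + 2 * geomConst p ^ (1 / p)) *
    (maxConst q' ^ (1 / q') * maxConst p ^ (1 / p))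

lemma suffConst_ne_top {p q' : ℝ} (hp : 1 < p) (hq' : 1 < q') : suffConst p q' ≠ ⊤ := by
  have h : ∀ s : ℝ, 1 < s → geomConst s ^ (1 / s) ≠ ⊤ ∧ maxConst s ^ (1 / s) ≠ ⊤ := fun s hs =>
    ⟨ENNReal.rpow_ne_top_of_nonneg (by positivity) (geomConst_ne_top (by linarith)),
      ENNReal.rpow_ne_top_of_nonneg (by positivity) (maxConst_ne_top hs)⟩
  obtain ⟨h1, h2⟩ := h p hp
  obtain ⟨h3, h4⟩ := h q' hq'
  exact ENNReal.mul_ne_top (ENNReal.mul_ne_top (by norm_num) (ENNReal.add_ne_top.2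
    ⟨ENNReal.mul_ne_top (by norm_num) h3, ENNReal.mul_ne_top (by norm_num) h1⟩))
    (ENNReal.mul_ne_top h4 h2)

lemma conj_exponents {p p' q q' r : ℝ} (hpp : p.HolderConjugate p') (hqq : q.HolderConjugate q')
    (hqp : q < p) (hr : 1 / q = 1 / r + 1 / p) : p' < q' ∧ 1 / p' = 1 / r + 1 / q' := by
  have h1 := hpp.inv_add_inv_eq_one
  have h2 := hqq.inv_add_inv_eq_one
  have h3 : p⁻¹ < q⁻¹ := (inv_lt_inv₀ hpp.pos hqq.pos).2 hqp
  refine ⟨(inv_lt_inv₀ hqq.symm.pos hpp.symm.pos).1 (by linarith), ?_⟩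
  simp only [one_div] at hr ⊢
  linarith

lemma IsLaminar.sum_bilinear_le [Countable ι] {c : ι → Set α} (hc : IsLaminar c)
    (hm : ∀ i, MeasurableSet (c i)) {σ ω : Measure α} (hσ : ∀ i, σ (c i) ≠ ⊤)
    (hω : ∀ i, ω (c i) ≠ ⊤) (K : ι → ℝ≥0∞) {p p' q q' r : ℝ} (hpp : p.HolderConjugate p')
    (hqq : q.HolderConjugate q') (hqp : q < p) (hr : 1 / q = 1 / r + 1 / p)
    {f g : α → ℝ≥0∞} (hf : Measurable f) (hg : Measurable g) (hft : ∫⁻ x, f x ^ p ∂σ ≠ ⊤)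
    (hgt : ∫⁻ x, g x ^ q' ∂ω ≠ ⊤) (S : Finset ι) :
    ∑ i ∈ S, K i * (∫⁻ x in c i, f x ∂σ) * ∫⁻ x in c i, g x ∂ω ≤
      suffConst p q' * max ((∫⁻ x, laminarWolff c K ω σ q x ^ (r / q) ∂σ) ^ (1 / r))
        ((∫⁻ x, laminarWolff c K σ ω p' x ^ (r / p') ∂ω) ^ (1 / r)) *
      ((∫⁻ x, f x ^ p ∂σ) ^ (1 / p) * (∫⁻ x, g x ^ q' ∂ω) ^ (1 / q')) := by
  obtain ⟨hpq', hr'⟩ := conj_exponents hpp hqq hqp hr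
  set N₁ := (∫⁻ x, laminarWolff c K ω σ q x ^ (r / q) ∂σ) ^ (1 / r)
  set N₂ := (∫⁻ x, laminarWolff c K σ ω p' x ^ (r / p') ∂ω) ^ (1 / r)
  set X := (∫⁻ x, f x ^ p ∂σ) ^ (1 / p) * (∫⁻ x, g x ^ q' ∂ω) ^ (1 / q') with hX
  set S' := S.filter fun i => (avg σ f (c i) ≠ 0 ∧ σ (c i) ≠ 0) ∧ avg ω g (c i) ≠ 0 ∧ ω (c i) ≠ 0
    with hS'
  have hmem : ∀ i ∈ S', (avg σ f (c i) ≠ 0 ∧ σ (c i) ≠ 0) ∧ avg ω g (c i) ≠ 0 ∧ ω (c i) ≠ 0 :=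
    fun i hi => (Finset.mem_filter.1 hi).2
  obtain ⟨m, hm1, hm2, hm3⟩ := exists_level (c := c) (μ := σ) (f := f) S'
    (fun i hi => (hmem i hi).1.1)
    fun i hi => avg_ne_top (hmem i hi).1.2 (hσ i) hpp.lt.le hft
  obtain ⟨l, hl1, hl2, hl3⟩ := exists_level (c := c) (μ := ω) (f := g) S'
    (fun i hi => (hmem i hi).2.1)
    fun i hi => avg_ne_top (hmem i hi).2.2 (hω i) hqq.symm.lt.le hgt
  obtain ⟨F, hFS, hF, hFm, hFd⟩ := hc.exists_stopping S' m hm2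
  obtain ⟨G, hGS, hG, hGl, hGd⟩ := hc.exists_stopping S' l hl2
  set e : ι → ℝ≥0∞ := fun i => K i * ω (c i) * σ (c i) * (2 ^ m i * 2 ^ l i) with he
  have hterm : ∀ i ∈ S', K i * (∫⁻ x in c i, f x ∂σ) * ∫⁻ x in c i, g x ∂ω ≤ 4 * e i := by
    intro i hi
    rw [← avg_mul_measure f (hσ i), ← avg_mul_measure g (hω i)]
    calc K i * (avg σ f (c i) * σ (c i)) * (avg ω g (c i) * ω (c i))
        ≤ K i * (2 * 2 ^ m i * σ (c i)) * (2 * 2 ^ l i * ω (c i)) := by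
          gcongr
          · exact hm1 i hi
          · exact hl1 i hi
      _ = 4 * e i := by
          rw [he]
          ring
  have hsplit : ∀ i ∈ S', m (G i) = m i ∨ l (F i) = l i := by
    intro i hi
    obtain ⟨x, hx⟩ := nonempty_of_measure_ne_zero (hmem i hi).1.2
    rcases hc (G i) (F i) with h | h | h
    · exact Or.inl (le_antisymm (hm2 i hi _ (hGS i hi) (hG i hi))
        ((hFm i hi).ge.trans (hm2 _ (hGS i hi) _ (hFS i hi) h)))
    · exact Or.inr (le_antisymm (hl2 i hi _ (hFS i hi) (hF i hi))
        ((hGl i hi).ge.trans (hl2 _ (hFS i hi) _ (hGS i hi) h)))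
    · exact absurd (hF i hi hx) (Set.disjoint_left.1 h (hG i hi hx))
  have hsub₁ : ∀ i ∈ S'.filter fun i => m (G i) = m i, i ∈ S' := fun i hi =>
    (Finset.mem_filter.1 hi).1
  have hsub₂ : ∀ i ∈ S'.filter fun i => ¬ m (G i) = m i, i ∈ S' := fun i hi =>
    (Finset.mem_filter.1 hi).1
  have hE₁ : ∑ i ∈ S' with m (G i) = m i, e i ≤
      2 * geomConst q' ^ (1 / q') * (maxConst q' ^ (1 / q') * maxConst p ^ (1 / p)) * N₁ * X := by
    refine hc.sum_le_wolff_norm_of_stopping hm hω hσ K hqq hqp hr _ (fun i hi => ?_) m l G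
      (fun i hi => hG i (hsub₁ i hi)) (fun i hi => (Finset.mem_filter.1 hi).2)
      (fun i hi => hGl i (hsub₁ i hi)) (fun i hi j hj => hGd i (hsub₁ i hi) j (hsub₁ j hj)) hf hg
      (fun i hi x hx => ?_) fun i hi => hm3 i (hsub₁ i hi)
    · exact (hmem i (hsub₁ i hi)).2.2
    · rw [← hGl i (hsub₁ i hi)]
      exact hl3 _ (hGS i (hsub₁ i hi)) x hx
  have hE₂ : ∑ i ∈ S' with ¬ m (G i) = m i, e i ≤
      2 * geomConst p ^ (1 / p) * (maxConst p ^ (1 / p) * maxConst q' ^ (1 / q')) * N₂ *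
        ((∫⁻ x, g x ^ q' ∂ω) ^ (1 / q') * (∫⁻ x, f x ^ p ∂σ) ^ (1 / p)) := by
    refine le_trans (le_of_eq (Finset.sum_congr rfl fun i _ => ?_))
      (hc.sum_le_wolff_norm_of_stopping hm hσ hω K hpp.symm hpq' hr' _ (fun i hi => ?_) l m F
      (fun i hi => hF i (hsub₂ i hi))
      (fun i hi => (hsplit i (hsub₂ i hi)).resolve_left (Finset.mem_filter.1 hi).2)
      (fun i hi => hFm i (hsub₂ i hi)) (fun i hi j hj => hFd i (hsub₂ i hi) j (hsub₂ j hj)) hg hf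
      (fun i hi x hx => ?_) fun i hi => hl3 i (hsub₂ i hi))
    · rw [he]
      ring
    · exact (hmem i (hsub₂ i hi)).1.2
    · rw [← hFm i (hsub₂ i hi)]
      exact hm3 _ (hFS i (hsub₂ i hi)) x hx
  calc ∑ i ∈ S, K i * (∫⁻ x in c i, f x ∂σ) * ∫⁻ x in c i, g x ∂ω
      = ∑ i ∈ S', K i * (∫⁻ x in c i, f x ∂σ) * ∫⁻ x in c i, g x ∂ω := by
        refine (Finset.sum_filter_of_ne fun i _ hne => ?_).symm
        rw [← avg_mul_measure f (hσ i), ← avg_mul_measure g (hω i)] at hne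
        have h1 := right_ne_zero_of_mul (left_ne_zero_of_mul hne)
        have h2 := right_ne_zero_of_mul hne
        exact ⟨⟨left_ne_zero_of_mul h1, right_ne_zero_of_mul h1⟩,
          left_ne_zero_of_mul h2, right_ne_zero_of_mul h2⟩
    _ ≤ ∑ i ∈ S', 4 * e i := Finset.sum_le_sum hterm
    _ = 4 * (∑ i ∈ S' with m (G i) = m i, e i + ∑ i ∈ S' with ¬ m (G i) = m i, e i) := by
        rw [← Finset.mul_sum, Finset.sum_filter_add_sum_filter_not]
    _ ≤ 4 * (2 * geomConst q' ^ (1 / q') * (maxConst q' ^ (1 / q') * maxConst p ^ (1 / p)) *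
          max N₁ N₂ * X + 2 * geomConst p ^ (1 / p) *
            (maxConst p ^ (1 / p) * maxConst q' ^ (1 / q')) * max N₁ N₂ *
          ((∫⁻ x, g x ^ q' ∂ω) ^ (1 / q') * (∫⁻ x, f x ^ p ∂σ) ^ (1 / p))) := by
        refine mul_le_mul_right (add_le_add (hE₁.trans ?_) (hE₂.trans ?_)) _
        · gcongr
          exact le_max_left _ _
        · gcongr
          exact le_max_right _ _
    _ = _ := by
        rw [hX, suffConst]
        ring

lemma IsLaminar.laminarOp_norm_le [Countable ι] {c : ι → Set α} (hc : IsLaminar c)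
    (hm : ∀ i, MeasurableSet (c i)) {σ ω : Measure α} [SigmaFinite ω] (hσ : ∀ i, σ (c i) ≠ ⊤)
    (hω : ∀ i, ω (c i) ≠ ⊤) (K : ι → ℝ≥0∞) {p p' q q' r : ℝ} (hpp : p.HolderConjugate p')
    (hqq : q.HolderConjugate q') (hqp : q < p) (hr : 1 / q = 1 / r + 1 / p)
    {f : α → ℝ≥0∞} (hf : Measurable f) (hft : ∫⁻ x, f x ^ p ∂σ ≠ ⊤) :
    (∫⁻ x, laminarOp c K σ f x ^ q ∂ω) ^ (1 / q) ≤
      suffConst p q' * max ((∫⁻ x, laminarWolff c K ω σ q x ^ (r / q) ∂σ) ^ (1 / r))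
        ((∫⁻ x, laminarWolff c K σ ω p' x ^ (r / p') ∂ω) ^ (1 / r)) *
      (∫⁻ x, f x ^ p ∂σ) ^ (1 / p) := by
  refine lintegral_rpow_le_of_forall_mul_le ω hqq (measurable_laminarOp hm K σ f) fun g hg hgt => ?_
  rw [lintegral_laminarOp_mul hm K σ ω f hg, ENNReal.tsum_eq_iSup_sum, mul_assoc]
  exact iSup_le fun S => hc.sum_bilinear_le hm hσ hω K hpp hqq hqp hr hf hg hft hgt S

/-- The two-weight trace inequality over a laminar family: the least constant is comparable with
the larger of the two Wolff potential norms. -/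
theorem IsLaminar.trace_characterization [Countable ι] {c : ι → Set α} (hc : IsLaminar c)
    (hm : ∀ i, MeasurableSet (c i)) {σ ω : Measure α} [SigmaFinite σ] [SigmaFinite ω]
    (hσ : ∀ i, σ (c i) ≠ ⊤) (hω : ∀ i, ω (c i) ≠ ⊤) (K : ι → ℝ≥0∞) {p p' q q' r : ℝ}
    (hpp : p.HolderConjugate p') (hqq : q.HolderConjugate q') (hqp : q < p)
    (hr : 1 / q = 1 / r + 1 / p) :
    (necConst p q + necConst q' p' + 1)⁻¹ *
        max ((∫⁻ x, laminarWolff c K ω σ q x ^ (r / q) ∂σ) ^ (1 / r))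
          ((∫⁻ x, laminarWolff c K σ ω p' x ^ (r / p') ∂ω) ^ (1 / r)) ≤
      sInf {C₁ : ℝ≥0∞ | ∀ f : α → ℝ≥0∞, Measurable f →
        (∫⁻ x, laminarOp c K σ f x ^ q ∂ω) ^ (1 / q) ≤ C₁ * (∫⁻ x, f x ^ p ∂σ) ^ (1 / p)} ∧
    sInf {C₁ : ℝ≥0∞ | ∀ f : α → ℝ≥0∞, Measurable f →
        (∫⁻ x, laminarOp c K σ f x ^ q ∂ω) ^ (1 / q) ≤ C₁ * (∫⁻ x, f x ^ p ∂σ) ^ (1 / p)} ≤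
      (suffConst p q' + 1) * max ((∫⁻ x, laminarWolff c K ω σ q x ^ (r / q) ∂σ) ^ (1 / r))
        ((∫⁻ x, laminarWolff c K σ ω p' x ^ (r / p') ∂ω) ^ (1 / r)) := by
  obtain ⟨hpq', hr'⟩ := conj_exponents hpp hqq hqp hr
  constructor
  · refine le_sInf fun C hC => ?_
    have hA : necConst p q + necConst q' p' + 1 ≠ ⊤ := by
      simp [necConst_ne_top hqq.lt hqp, necConst_ne_top hpp.symm.lt hpq']
    have h1 := hc.wolff_norm_le hm hσ hω K hqq.lt hqp hr hC
    have h2 := hc.wolff_norm_le hm hω hσ K hpp.symm.lt hpq' hr'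
      (laminarOp_dual_bound hm K σ ω hpp hqq hC)
    rw [ENNReal.inv_mul_le_iff (by simp) hA]
    refine max_le (h1.trans ?_) (h2.trans ?_)
    · gcongr
      exact le_add_right le_self_add
    · gcongr
      exact le_add_right le_add_self
  · set N := max ((∫⁻ x, laminarWolff c K ω σ q x ^ (r / q) ∂σ) ^ (1 / r))
      ((∫⁻ x, laminarWolff c K σ ω p' x ^ (r / p') ∂ω) ^ (1 / r)) with hN
    refine le_trans (ENNReal.le_of_forall_pos_le_add fun ε hε _ => sInf_le fun f hf => ?_)
      (mul_le_mul_left (le_self_add (a := suffConst p q') (b := 1)) N)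
    rcases eq_or_ne (∫⁻ x, f x ^ p ∂σ) ⊤ with hft | hft
    · have hε0 : suffConst p q' * N + ε ≠ 0 := by simp [hε.ne']
      rw [hft, ENNReal.top_rpow_of_pos (one_div_pos.2 hpp.pos), ENNReal.mul_top hε0]
      exact le_top
    · refine (hc.laminarOp_norm_le hm hσ hω K hpp hqq hqp hr hf hft).trans ?_
      gcongr
      exact le_self_add

end Laminar

/-! ### Dyadic cubes -/

lemma cube_subset_or_disjoint {n : ℕ} {i j : ℤ} (hij : i ≤ j) (k l : Fin n → ℤ) :
    cube n (j, l) ⊆ cube n (i, k) ∨ Disjoint (cube n (j, l)) (cube n (i, k)) := by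
  refine or_iff_not_imp_right.2 fun hd x hx a => ?_
  obtain ⟨z, hz1, hz2⟩ := Set.not_disjoint_iff.1 hd
  obtain ⟨h1, h2⟩ := hz1 a
  obtain ⟨h3, h4⟩ := hz2 a
  obtain ⟨h5, h6⟩ := hx a
  obtain ⟨d, rfl⟩ := Int.le.dest hij
  have hscale : (2 : ℝ) ^ (-i) = ((2 ^ d : ℤ) : ℝ) * 2 ^ (-(i + d)) := by
    push_cast
    rw [← zpow_natCast (2 : ℝ) d, ← zpow_add₀ two_ne_zero]
    congr 1
    ring
  dsimp only at *
  have hpos : (0 : ℝ) < 2 ^ (-(i + d)) := by positivity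
  rw [hscale, ← mul_assoc] at h3 h4 ⊢
  have h7 : k a * 2 ^ d < l a + 1 := by
    exact_mod_cast lt_of_mul_lt_mul_right (h3.trans_lt h2) hpos.le
  have h8 : l a < (k a + 1) * 2 ^ d := by
    exact_mod_cast lt_of_mul_lt_mul_right (h1.trans_lt h4) hpos.le
  have h9 : ((k a * 2 ^ d : ℤ) : ℝ) ≤ l a := by exact_mod_cast Int.lt_add_one_iff.1 h7
  have h10 : ((l a + 1 : ℤ) : ℝ) ≤ ((k a + 1) * 2 ^ d : ℤ) := by exact_mod_cast h8
  push_cast at h9 h10 ⊢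
  rw [← mul_assoc]
  exact ⟨(mul_le_mul_of_nonneg_right h9 hpos.le).trans h5,
    h6.trans_le (mul_le_mul_of_nonneg_right h10 hpos.le)⟩

lemma isLaminar_cube (n : ℕ) : IsLaminar (cube n) := by
  rintro ⟨i, k⟩ ⟨j, l⟩
  rcases le_total i j with h | h
  · rcases cube_subset_or_disjoint h k l with h | h
    · exact Or.inr (Or.inl h)
    · exact Or.inr (Or.inr h.symm)
  · rcases cube_subset_or_disjoint h l k with h | h
    · exact Or.inl h
    · exact Or.inr (Or.inr h)

lemma measurableSet_cube {n : ℕ} (P : ℤ × (Fin n → ℤ)) : MeasurableSet (cube n P) := by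
  have : cube n P = Set.univ.pi fun j =>
      Set.Ico ((P.2 j : ℝ) * 2 ^ (-P.1)) (((P.2 j : ℝ) + 1) * 2 ^ (-P.1)) := by
    ext x
    simp [cube, dyadicCube, Set.mem_pi]
  rw [this]
  exact MeasurableSet.univ_pi fun j => measurableSet_Ico

lemma measure_cube_ne_top {n : ℕ} {μ : Measure (Fin n → ℝ)} [IsLocallyFiniteMeasure μ]
    (P : ℤ × (Fin n → ℤ)) : μ (cube n P) ≠ ⊤ := by
  have hsub : cube n P ⊆ Set.Icc (fun j => (P.2 j : ℝ) * 2 ^ (-P.1))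
      fun j => ((P.2 j : ℝ) + 1) * 2 ^ (-P.1) :=
    fun x hx => ⟨fun j => (hx j).1, fun j => (hx j).2.le⟩
  exact ((measure_mono hsub).trans_lt isCompact_Icc.measure_lt_top).ne

lemma setLIntegral_Kbar {n : ℕ} (K : ℤ × (Fin n → ℤ) → ℝ≥0∞) (μ ν : Measure (Fin n → ℝ))
    (P : ℤ × (Fin n → ℤ)) :
    ∫⁻ y in cube n P, Kbar n K μ P y ∂ν = localMass (cube n) K μ ν P / μ (cube n P) := by
  have hmeas : ∀ P' : ℤ × (Fin n → ℤ), Measurable fun x => if cube n P' ⊆ cube n P then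
      (cube n P').indicator (fun _ => K P' * μ (cube n P')) x else 0 := fun P' => by
    split_ifs
    · exact measurable_const.indicator (measurableSet_cube P')
    · exact measurable_const
  simp only [Kbar, div_eq_mul_inv]
  rw [lintegral_mul_const _ (Measurable.tsum hmeas), lintegral_tsum fun P' => (hmeas P').aemeasurable,
    localMass]
  congr 2
  funext P'
  split_ifs with h
  · rw [lintegral_indicator_const (measurableSet_cube P'),
      Measure.restrict_apply (measurableSet_cube P'), Set.inter_eq_left.2 h]
  · exact lintegral_zero

lemma wolff_eq_laminarWolff {n : ℕ} (K : ℤ × (Fin n → ℤ) → ℝ≥0∞) (μ ν : Measure (Fin n → ℝ))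
    (s : ℝ) (x : Fin n → ℝ) : wolff n K μ ν s x = laminarWolff (cube n) K μ ν s x := by
  simp only [wolff, laminarWolff, setLIntegral_Kbar K μ ν]


/-- Theorem 1.3: two weight `T1` theorem, upper triangle case.  The least constant `C₁`
in the trace inequality is comparable with `C₂`, the maximum of the two Wolff potential
norms; in particular one is finite iff the other is. -/
theorem two_weight_trace_characterization (n : ℕ) (p q r : ℝ)
    (hq : 1 < q) (hqp : q < p) (hr : 1 / q = 1 / r + 1 / p) :
    ∃ c C : ℝ≥0∞, 0 < c ∧ c < ⊤ ∧ 0 < C ∧ C < ⊤ ∧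
      ∀ (σ ω : Measure (Fin n → ℝ)), IsLocallyFiniteMeasure σ →
        IsLocallyFiniteMeasure ω → ∀ K : ℤ × (Fin n → ℤ) → ℝ≥0∞,
        c * max ((∫⁻ x, wolff n K ω σ q x ^ (r / q) ∂σ) ^ (1 / r))
              ((∫⁻ x, wolff n K σ ω (p / (p - 1)) x ^ (r / (p / (p - 1))) ∂ω) ^ (1 / r)) ≤
            sInf {C₁ : ℝ≥0∞ | ∀ f : (Fin n → ℝ) → ℝ≥0∞, Measurable f →
              (∫⁻ x, dyadicOp n K σ f x ^ q ∂ω) ^ (1 / q) ≤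
                C₁ * (∫⁻ x, f x ^ p ∂σ) ^ (1 / p)} ∧
          sInf {C₁ : ℝ≥0∞ | ∀ f : (Fin n → ℝ) → ℝ≥0∞, Measurable f →
              (∫⁻ x, dyadicOp n K σ f x ^ q ∂ω) ^ (1 / q) ≤
                C₁ * (∫⁻ x, f x ^ p ∂σ) ^ (1 / p)} ≤
            C * max ((∫⁻ x, wolff n K ω σ q x ^ (r / q) ∂σ) ^ (1 / r))
              ((∫⁻ x, wolff n K σ ω (p / (p - 1)) x ^ (r / (p / (p - 1))) ∂ω) ^ (1 / r)) := by
  have hqq := Real.HolderConjugate.conjExponent hq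
  have hpp := Real.HolderConjugate.conjExponent (hq.trans hqp)
  obtain ⟨hpq', -⟩ := conj_exponents hpp hqq hqp hr
  have hnec : necConst p q + necConst q.conjExponent p.conjExponent + 1 ≠ ⊤ := by
    simp [necConst_ne_top hq hqp, necConst_ne_top hpp.symm.lt hpq']
  refine ⟨(necConst p q + necConst q.conjExponent p.conjExponent + 1)⁻¹,
    suffConst p q.conjExponent + 1, ENNReal.inv_pos.2 hnec,
    (ENNReal.inv_ne_top.2 (by simp)).lt_top, by simp,
    (ENNReal.add_ne_top.2 ⟨suffConst_ne_top (hq.trans hqp) hqq.symm.lt, ENNReal.one_ne_top⟩).lt_top,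
    fun σ ω hσ hω K => ?_⟩
  have key := (isLaminar_cube n).trace_characterization measurableSet_cube
    (σ := σ) (ω := ω) measure_cube_ne_top measure_cube_ne_top K hpp hqq hqp hr
  simp only [wolff_eq_laminarWolff]
  exact key

end
end
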